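/- There is an absolute constant C > 0 with the following property. Let P be a finite set of n points in ℝ² and let k be an integer with 1 ≤ k and 3k < n. Then there exist finitely many convex regions C_1, …, C_u in ℝ², each an intersection of at most three closed halfplanes, with pairwise disjoint interiors, such that: (1) P \ D_k(P) ⊆ C_1 ∪ ⋯ ∪ C_u; (2) each C_i contains at most 2k points of P \ D_k(P); (3) each C_i has nonempty intersection with the boundary of D_k(P); and (4) every line in ℝ² intersects at most C·log(2n/k) of the regions C_1, …, C_u. -/

import Mathlib

/-- A closed halfplane in `ℝ²`: the set `{x | 0 ≤ a·x₁ + b·x₂ + c}` for a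
nonconstant affine function. -/
def IsClosedHalfplane (H : Set (ℝ × ℝ)) : Prop :=
  ∃ a b c : ℝ, (a, b) ≠ (0, 0) ∧ H = {x : ℝ × ℝ | 0 ≤ a * x.1 + b * x.2 + c}

/-- `Dk P k` is the intersection of all closed halfplanes containing at least
`|P| − k` points of `P`. -/
noncomputable def Dk (P : Finset (ℝ × ℝ)) (k : ℕ) : Set (ℝ × ℝ) :=
  ⋂₀ {H : Set (ℝ × ℝ) | IsClosedHalfplane H ∧
      (P.card : ℤ) - (k : ℤ) ≤ (((↑P : Set (ℝ × ℝ)) ∩ H).ncard : ℤ)}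

namespace ShallowCover

/-- A node of a binary subdivision of an interval of directions: the interval `[lo, hi]`, together
with the direction at which it is split, if it is split. -/
structure Label where
  lo : ℝ
  hi : ℝ
  cut : Option ℝ

/-- The set `J` meets the interval of the label, but does not contain both of its endpoints. -/
def Label.Hit (J : Set ℝ) (L : Label) : Prop :=
  (∃ z ∈ J, L.lo ≤ z ∧ z ≤ L.hi) ∧ ¬ (L.lo ∈ J ∧ L.hi ∈ J)

/-- The intervals of two labels do not overlap, or one of them avoids the split direction of the
other. -/
def Label.Sep (L M : Label) : Prop :=
  L.hi ≤ M.lo ∨ M.hi ≤ L.lo ∨ (∃ w ∈ L.cut, ¬ (M.lo < w ∧ w < M.hi)) ∨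
    (∃ w ∈ M.cut, ¬ (L.lo < w ∧ w < L.hi))

theorem Label.Sep.symm {L M : Label} (h : L.Sep M) : M.Sep L := by
  rcases h with h | h | h | h
  · exact Or.inr (Or.inl h)
  · exact Or.inl h
  · exact Or.inr (Or.inr (Or.inr h))
  · exact Or.inr (Or.inr (Or.inl h))

section Tree

variable {ι : Type*} (Q : Finset ι) (α β : ι → ℝ)

open Classical in
/-- The members of `Q` whose arc `(α q, β q)` lies in `[a, b]`. -/
noncomputable def arcsIn (a b : ℝ) : Finset ι := Q.filter fun q => a ≤ α q ∧ β q ≤ b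

theorem mem_arcsIn {a b : ℝ} {q : ι} : q ∈ arcsIn Q α β a b ↔ q ∈ Q ∧ a ≤ α q ∧ β q ≤ b := by
  simp [arcsIn]

theorem arcsIn_mono {a b a' b' : ℝ} (ha : a ≤ a') (hb : b' ≤ b) :
    arcsIn Q α β a' b' ⊆ arcsIn Q α β a b := by
  intro q
  simp only [mem_arcsIn]
  rintro ⟨h, h1, h2⟩
  exact ⟨h, ha.trans h1, h2.trans hb⟩

open Classical in
/-- `T` is the set of labels of a subdivision of `[l, r]`, of depth at most `d`, whose unsplit
labels contain at most `N` arcs. -/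
structure IsSubdivision (N : ℕ) (B : Set ℝ) (d : ℕ) (l r : ℝ) (T : Finset Label) : Prop where
  bounds : ∀ L ∈ T, l ≤ L.lo ∧ L.lo < L.hi ∧ L.hi ≤ r
  pos : ∀ L ∈ T, (arcsIn Q α β L.lo L.hi).Nonempty
  leaf : ∀ L ∈ T, L.cut = none → (arcsIn Q α β L.lo L.hi).card ≤ N
  cut : ∀ L ∈ T, ∀ w ∈ L.cut, L.lo < w ∧ w < L.hi ∧ w ∉ B
  covers : ∀ q ∈ arcsIn Q α β l r, ∃ L ∈ T, L.lo ≤ α q ∧ β q ≤ L.hi ∧ ∀ w ∈ L.cut, α q < w ∧ w < β q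
  sep : ∀ L ∈ T, ∀ M ∈ T, L ≠ M → L.Sep M
  hit_one : ∀ J : Set ℝ, J.OrdConnected → (l ∈ J ∨ r ∈ J) → (T.filter (Label.Hit J)).card ≤ d + 1
  hit_all : ∀ J : Set ℝ, J.OrdConnected → (T.filter (Label.Hit J)).card ≤ 2 * (d + 1)

variable {Q α β}

open Classical in
theorem IsSubdivision.hit_both {N : ℕ} {B : Set ℝ} {d : ℕ} {l r : ℝ} {T : Finset Label}
    (hT : IsSubdivision Q α β N B d l r T) {J : Set ℝ} (hJ : J.OrdConnected)
    (hl : l ∈ J) (hr : r ∈ J) : (T.filter (Label.Hit J)).card = 0 := by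
  rw [Finset.card_eq_zero, Finset.filter_eq_empty_iff]
  intro L hL h
  obtain ⟨h1, h2, h3⟩ := hT.bounds L hL
  exact h.2 ⟨hJ.out hl hr ⟨h1, h2.le.trans h3⟩, hJ.out hl hr ⟨h1.trans h2.le, h3⟩⟩

open Classical in
theorem IsSubdivision.hit_none {N : ℕ} {B : Set ℝ} {d : ℕ} {l r : ℝ} {T : Finset Label}
    (hT : IsSubdivision Q α β N B d l r T) {J : Set ℝ}
    (h : ∀ z ∈ J, l ≤ z → ¬ z ≤ r) : (T.filter (Label.Hit J)).card = 0 := by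
  rw [Finset.card_eq_zero, Finset.filter_eq_empty_iff]
  rintro L hL ⟨⟨z, hz, h4, h5⟩, -⟩
  obtain ⟨h1, h2, h3⟩ := hT.bounds L hL
  exact h z hz (h1.trans h4) (h5.trans h3)

theorem IsSubdivision.mono {N : ℕ} {B : Set ℝ} {d d' : ℕ} {l r : ℝ} {T : Finset Label}
    (hT : IsSubdivision Q α β N B d l r T) (hd : d ≤ d') :
    IsSubdivision Q α β N B d' l r T where
  bounds := hT.bounds
  pos := hT.pos
  leaf := hT.leaf
  cut := hT.cut
  covers := hT.covers
  sep := hT.sep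
  hit_one J hJ h := (hT.hit_one J hJ h).trans (by omega)
  hit_all J hJ := (hT.hit_all J hJ).trans (by omega)

theorem isSubdivision_empty (N : ℕ) (B : Set ℝ) (d : ℕ) {l r : ℝ}
    (h : arcsIn Q α β l r = ∅) : IsSubdivision Q α β N B d l r ∅ := by
  constructor <;> simp [h]

theorem isSubdivision_singleton {N : ℕ} (B : Set ℝ) (d : ℕ) {l r : ℝ} (hlr : l < r)
    (h : (arcsIn Q α β l r).Nonempty) (hN : (arcsIn Q α β l r).card ≤ N) :
    IsSubdivision Q α β N B d l r {⟨l, r, none⟩} := by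
  classical
  constructor
  · simp [hlr]
  · simpa using h
  · simpa using hN
  · simp
  · intro q hq
    rw [mem_arcsIn] at hq
    simp [hq.2.1, hq.2.2]
  · intro L hL M hM hne
    simp only [Finset.mem_singleton] at hL hM
    exact absurd (hL.trans hM.symm) hne
  · intro J _ _
    exact (Finset.card_filter_le _ _).trans (by simp)
  · intro J _
    exact (Finset.card_filter_le _ _).trans (by simp; omega)

/-- A balanced splitting value for the arcs in `[l, r]`, avoiding a finite set. -/
theorem exists_balanced_split (hαβ : ∀ q ∈ Q, α q < β q) {B : Set ℝ} (hB : B.Finite)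
    {m : ℕ} {l r : ℝ} (hm : m < (arcsIn Q α β l r).card) (hm2 : (arcsIn Q α β l r).card ≤ 2 * m) :
    ∃ w, l < w ∧ w < r ∧ w ∉ B ∧ (arcsIn Q α β l w).card ≤ m ∧ (arcsIn Q α β w r).card ≤ m := by
  classical
  set S := arcsIn Q α β l r with hS
  have hSm : ∀ q ∈ S, q ∈ Q ∧ l ≤ α q ∧ β q ≤ r := fun q hq => (mem_arcsIn Q α β).1 hq
  have hSne : S.Nonempty := Finset.card_pos.1 (by omega)
  obtain ⟨q1, hq1, hq1max⟩ := Finset.exists_max_image S β hSne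
  let C := S.filter fun q => m < (S.filter fun p => β p ≤ β q).card
  have hCne : C.Nonempty := by
    refine ⟨q1, Finset.mem_filter.2 ⟨hq1, ?_⟩⟩
    rwa [Finset.filter_true_of_mem hq1max]
  obtain ⟨q0, hq0, hmin⟩ := Finset.exists_min_image C β hCne
  obtain ⟨hq0S, hq0c⟩ := Finset.mem_filter.1 hq0
  obtain ⟨a, hal, har, hamax⟩ : ∃ a, l ≤ a ∧ a < β q0 ∧ ∀ p ∈ S, α p < β q0 → α p ≤ a := by
    have hq0' : q0 ∈ S.filter fun p => α p < β q0 :=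
      Finset.mem_filter.2 ⟨hq0S, hαβ _ (hSm _ hq0S).1⟩
    obtain ⟨p0, hp0, hp0max⟩ := Finset.exists_max_image (S.filter fun p => α p < β q0) α ⟨_, hq0'⟩
    obtain ⟨h1, h2⟩ := Finset.mem_filter.1 hp0
    exact ⟨α p0, (hSm _ h1).2.1, h2, fun p hp hpq => hp0max p (Finset.mem_filter.2 ⟨hp, hpq⟩)⟩
  obtain ⟨w, hw, hwB⟩ := (Set.Ioo_infinite har).exists_notMem_finite hB
  refine ⟨w, hal.trans_lt hw.1, hw.2.trans_le (hSm _ hq0S).2.2, hwB, ?_, ?_⟩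
  · by_contra hcon
    push Not at hcon
    obtain ⟨p, hp, hpmax⟩ := Finset.exists_max_image (arcsIn Q α β l w) β
      (Finset.card_pos.1 (by omega))
    have hsub : arcsIn Q α β l w ⊆ S :=
      arcsIn_mono Q α β le_rfl (hw.2.le.trans (hSm _ hq0S).2.2)
    have hpC : p ∈ C := by
      refine Finset.mem_filter.2 ⟨hsub hp, hcon.trans_le (Finset.card_le_card fun x hx => ?_)⟩
      exact Finset.mem_filter.2 ⟨hsub hx, hpmax x hx⟩
    have h1 := hmin p hpC
    have h2 := ((mem_arcsIn Q α β).1 hp).2.2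
    linarith [hw.2]
  · have hsub : arcsIn Q α β w r ⊆ S := arcsIn_mono Q α β (hal.trans hw.1.le) le_rfl
    have hsub2 : arcsIn Q α β w r ⊆ S \ S.filter fun p => β p ≤ β q0 := by
      intro x hx
      refine Finset.mem_sdiff.2 ⟨hsub hx, fun hx2 => ?_⟩
      have h1 := (Finset.mem_filter.1 hx2).2
      have h2 := hαβ x (hSm x (hsub hx)).1
      have h3 := hamax x (hsub hx) (by linarith)
      have h4 := ((mem_arcsIn Q α β).1 hx).2.1
      linarith [hw.1]
    have h1 := Finset.card_le_card hsub2
    rw [Finset.card_sdiff_of_subset (Finset.filter_subset _ _)] at h1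
    omega

open Classical in
theorem IsSubdivision.node {N : ℕ} {B : Set ℝ} {d : ℕ} {l w r : ℝ} {T₁ T₂ : Finset Label}
    (h1 : IsSubdivision Q α β N B d l w T₁) (h2 : IsSubdivision Q α β N B d w r T₂)
    (hlw : l < w) (hwr : w < r) (hwB : w ∉ B) (hne : (arcsIn Q α β l r).Nonempty) :
    IsSubdivision Q α β N B (d + 1) l r (insert ⟨l, r, some w⟩ (T₁ ∪ T₂)) := by
  have hcard : ∀ J : Set ℝ,
      ((insert ⟨l, r, some w⟩ (T₁ ∪ T₂) : Finset Label).filter (Label.Hit J)).card ≤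
        1 + ((T₁.filter (Label.Hit J)).card + (T₂.filter (Label.Hit J)).card) := by
    intro J
    rw [Finset.filter_insert, Finset.filter_union]
    have := Finset.card_union_le (T₁.filter (Label.Hit J)) (T₂.filter (Label.Hit J))
    split_ifs
    · have := Finset.card_insert_le (⟨l, r, some w⟩ : Label)
        (T₁.filter (Label.Hit J) ∪ T₂.filter (Label.Hit J))
      omega
    · omega
  have hroot1 : ∀ M ∈ T₁, Label.Sep ⟨l, r, some w⟩ M := fun M hM =>
    Or.inr <| Or.inr <| Or.inl ⟨w, rfl, fun h => by linarith [(h1.bounds M hM).2.2, h.2]⟩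
  have hroot2 : ∀ M ∈ T₂, Label.Sep ⟨l, r, some w⟩ M := fun M hM =>
    Or.inr <| Or.inr <| Or.inl ⟨w, rfl, fun h => by linarith [(h2.bounds M hM).1, h.1]⟩
  have h12 : ∀ L ∈ T₁, ∀ M ∈ T₂, L.Sep M := fun L hL M hM =>
    Or.inl ((h1.bounds L hL).2.2.trans (h2.bounds M hM).1)
  constructor
  · intro L hL
    simp only [Finset.mem_insert, Finset.mem_union] at hL
    rcases hL with rfl | hL | hL
    · exact ⟨le_rfl, hlw.trans hwr, le_rfl⟩
    · obtain ⟨h3, h4, h5⟩ := h1.bounds L hL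
      exact ⟨h3, h4, h5.trans hwr.le⟩
    · obtain ⟨h3, h4, h5⟩ := h2.bounds L hL
      exact ⟨hlw.le.trans h3, h4, h5⟩
  · intro L hL
    simp only [Finset.mem_insert, Finset.mem_union] at hL
    rcases hL with rfl | hL | hL
    · exact hne
    · exact h1.pos L hL
    · exact h2.pos L hL
  · intro L hL
    simp only [Finset.mem_insert, Finset.mem_union] at hL
    rcases hL with rfl | hL | hL
    · simp
    · exact h1.leaf L hL
    · exact h2.leaf L hL
  · intro L hL
    simp only [Finset.mem_insert, Finset.mem_union] at hL
    rcases hL with rfl | hL | hL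
    · rintro v hv
      obtain rfl : w = v := by simpa using hv
      exact ⟨hlw, hwr, hwB⟩
    · exact h1.cut L hL
    · exact h2.cut L hL
  · intro q hq
    obtain ⟨hqQ, hq1, hq2⟩ := (mem_arcsIn Q α β).1 hq
    rcases le_or_gt (β q) w with h | h
    · obtain ⟨L, hL, h3⟩ := h1.covers q ((mem_arcsIn Q α β).2 ⟨hqQ, hq1, h⟩)
      exact ⟨L, by simp [hL], h3⟩
    rcases le_or_gt w (α q) with h' | h'
    · obtain ⟨L, hL, h3⟩ := h2.covers q ((mem_arcsIn Q α β).2 ⟨hqQ, h', hq2⟩)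
      exact ⟨L, by simp [hL], h3⟩
    refine ⟨_, Finset.mem_insert_self _ _, hq1, hq2, ?_⟩
    rintro v hv
    obtain rfl : w = v := by simpa using hv
    exact ⟨h', h⟩
  · intro L hL M hM hLM
    simp only [Finset.mem_insert, Finset.mem_union] at hL hM
    rcases hL with rfl | hL | hL <;> rcases hM with rfl | hM | hM
    · exact absurd rfl hLM
    · exact hroot1 M hM
    · exact hroot2 M hM
    · exact (hroot1 L hL).symm
    · exact h1.sep L hL M hM hLM
    · exact h12 L hL M hM
    · exact (hroot2 L hL).symm
    · exact (h12 M hM L hL).symm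
    · exact h2.sep L hL M hM hLM
  · intro J hJ hlr
    have hc := hcard J
    by_cases hw : w ∈ J
    · have h3 := h1.hit_one J hJ (Or.inr hw)
      have h4 := h2.hit_one J hJ (Or.inl hw)
      rcases hlr with hl | hr
      · have := h1.hit_both hJ hl hw
        omega
      · have := h2.hit_both hJ hw hr
        omega
    · rcases hlr with hl | hr
      · have h3 := h1.hit_one J hJ (Or.inl hl)
        have h4 := h2.hit_none (J := J) fun z hz h5 _ => hw (hJ.out hl hz ⟨hlw.le, h5⟩)
        omega
      · have h3 := h2.hit_one J hJ (Or.inr hr)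
        have h4 := h1.hit_none (J := J) fun z hz _ h5 => hw (hJ.out hz hr ⟨h5, hwr.le⟩)
        omega
  · intro J hJ
    have hc := hcard J
    by_cases hw : w ∈ J
    · have h3 := h1.hit_one J hJ (Or.inr hw)
      have h4 := h2.hit_one J hJ (Or.inl hw)
      omega
    · by_cases h : ∃ z ∈ J, z ≤ w
      · obtain ⟨z, hz, hzw⟩ := h
        have h3 := h1.hit_all J hJ
        have h4 := h2.hit_none (J := J) fun y hy h5 _ => hw (hJ.out hz hy ⟨hzw, h5⟩)
        omega
      · push Not at h
        have h3 := h2.hit_all J hJ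
        have h4 := h1.hit_none (J := J) fun y hy _ h5 => (h y hy).not_ge h5
        omega

theorem exists_isSubdivision (hαβ : ∀ q ∈ Q, α q < β q) {B : Set ℝ} (hB : B.Finite) (N d : ℕ) :
    ∀ l r : ℝ, l < r → (arcsIn Q α β l r).card ≤ N * 2 ^ d →
      ∃ T, IsSubdivision Q α β N B d l r T := by
  classical
  induction d with
  | zero =>
    intro l r hlr h
    rcases (arcsIn Q α β l r).eq_empty_or_nonempty with h0 | h0
    · exact ⟨_, isSubdivision_empty N B 0 h0⟩
    · exact ⟨_, isSubdivision_singleton B 0 hlr h0 (by simpa using h)⟩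
  | succ d ih =>
    intro l r hlr h
    rcases le_or_gt (arcsIn Q α β l r).card (N * 2 ^ d) with h0 | h0
    · obtain ⟨T, hT⟩ := ih l r hlr h0
      exact ⟨T, hT.mono (Nat.le_succ d)⟩
    · obtain ⟨w, hlw, hwr, hwB, hw1, hw2⟩ :=
        exists_balanced_split hαβ hB h0 (by rw [pow_succ] at h; linarith)
      obtain ⟨T₁, hT₁⟩ := ih l w hlw hw1
      obtain ⟨T₂, hT₂⟩ := ih w r hwr hw2
      exact ⟨_, hT₁.node hT₂ hlw hwr hwB (Finset.card_pos.1 (by omega))⟩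

end Tree

section ShallowHull

variable {P : Finset (ℝ × ℝ)} {k : ℕ}

/-- The subsets of `P` missing at most `k` points. -/
def coSmall (P : Finset (ℝ × ℝ)) (k : ℕ) : Finset (Finset (ℝ × ℝ)) :=
  P.powerset.filter fun S => P.card ≤ S.card + k

theorem mem_coSmall {S : Finset (ℝ × ℝ)} :
    S ∈ coSmall P k ↔ S ⊆ P ∧ P.card ≤ S.card + k := by
  simp [coSmall]

theorem convex_halfplane (a b c : ℝ) : Convex ℝ {x : ℝ × ℝ | 0 ≤ a * x.1 + b * x.2 + c} := by
  intro x hx y hy s t hs ht hst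
  simp only [Set.mem_ofPred_eq, Prod.fst_add, Prod.snd_add, Prod.smul_fst, Prod.smul_snd,
    smul_eq_mul] at *
  have : a * (s * x.1 + t * y.1) + b * (s * x.2 + t * y.2) + c =
      s * (a * x.1 + b * x.2 + c) + t * (a * y.1 + b * y.2 + c) := by
    linear_combination (-c) * hst
  rw [this]
  positivity

theorem Dk_eq (hk : k < P.card) :
    Dk P k = ⋂ S ∈ coSmall P k, convexHull ℝ (S : Set (ℝ × ℝ)) := by
  classical
  apply Set.Subset.antisymm
  · intro x hx
    rw [Set.mem_iInter₂]
    intro S hS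
    obtain ⟨hSP, hSc⟩ := mem_coSmall.1 hS
    by_contra hxS
    obtain ⟨f, u, hf, hfx⟩ := geometric_hahn_banach_closed_point (convex_convexHull ℝ _)
      (S.finite_toSet.isCompact_convexHull ℝ).isClosed hxS
    have hfe : ∀ p : ℝ × ℝ, f p = f (1, 0) * p.1 + f (0, 1) * p.2 := by
      intro p
      have : p = p.1 • ((1, 0) : ℝ × ℝ) + p.2 • ((0, 1) : ℝ × ℝ) := by ext <;> simp
      conv_lhs => rw [this]
      rw [map_add, map_smul, map_smul, smul_eq_mul, smul_eq_mul]
      ring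
    have hS0 : S.Nonempty := Finset.card_pos.1 (by omega)
    obtain ⟨s0, hs0⟩ := hS0
    have hmem : ∀ s ∈ S, f s < u := fun s hs => hf s (subset_convexHull ℝ _ hs)
    have hx' := Set.mem_sInter.1 hx {x : ℝ × ℝ | 0 ≤ -f (1, 0) * x.1 + -f (0, 1) * x.2 + u} ⟨?_, ?_⟩
    · simp only [Set.mem_ofPred_eq] at hx'
      rw [hfe x] at hfx
      linarith
    · refine ⟨_, _, _, ?_, rfl⟩
      intro h0
      have h1 := hmem s0 hs0
      simp only [Prod.mk.injEq, neg_eq_zero] at h0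
      rw [hfe, h0.1, h0.2] at h1 hfx
      linarith
    · have : S.card ≤ (((P : Set (ℝ × ℝ)) ∩
          {x : ℝ × ℝ | 0 ≤ -f (1, 0) * x.1 + -f (0, 1) * x.2 + u})).ncard := by
        rw [← Set.ncard_coe_finset]
        refine Set.ncard_le_ncard (fun s hs => ⟨hSP hs, ?_⟩) (P.finite_toSet.inter_of_left _)
        have h1 := hmem s hs
        rw [hfe] at h1
        simp only [Set.mem_ofPred_eq]
        linarith
      omega
  · intro x hx
    rw [Dk, Set.mem_sInter]
    rintro H ⟨⟨a, b, c, -, rfl⟩, hH⟩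
    set H := {x : ℝ × ℝ | 0 ≤ a * x.1 + b * x.2 + c} with hHdef
    have hfin : ((P : Set (ℝ × ℝ)) ∩ H).Finite := P.finite_toSet.inter_of_left _
    have h1 := Set.mem_iInter₂.1 hx hfin.toFinset (mem_coSmall.2 ⟨fun p hp => ?_, ?_⟩)
    · refine convexHull_min ?_ (convex_halfplane a b c) h1
      intro p hp
      simp only [Set.Finite.coe_toFinset] at hp
      exact hp.2
    · exact ((hfin.mem_toFinset).1 hp).1
    · rw [Set.ncard_eq_toFinset_card _ hfin] at hH
      omega

theorem convex_Dk (P : Finset (ℝ × ℝ)) (k : ℕ) : Convex ℝ (Dk P k) := by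
  refine convex_sInter ?_
  rintro H ⟨⟨a, b, c, -, rfl⟩, -⟩
  exact convex_halfplane a b c

theorem isCompact_Dk (hk : k < P.card) : IsCompact (Dk P k) := by
  rw [Dk_eq hk]
  refine IsCompact.of_isClosed_subset (P.finite_toSet.isCompact_convexHull ℝ) ?_
    (Set.biInter_subset_of_mem (mem_coSmall.2 ⟨Finset.Subset.refl P, by omega⟩))
  exact isClosed_biInter fun S _ => (S.finite_toSet.isCompact_convexHull ℝ).isClosed

/-- A convex set with more than `2k` points of `P` meets `Dk P k`. -/
theorem inter_Dk_nonempty (hk : 3 * k < P.card) {G : Set (ℝ × ℝ)} (hG : Convex ℝ G)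
    (h : 2 * k < ((P : Set (ℝ × ℝ)) ∩ G).ncard) : (G ∩ Dk P k).Nonempty := by
  classical
  have hfin : ((P : Set (ℝ × ℝ)) ∩ G).Finite := P.finite_toSet.inter_of_left _
  rw [Set.ncard_eq_toFinset_card _ hfin] at h
  set S₀ := hfin.toFinset with hS₀
  have hS₀P : S₀ ⊆ P := fun p hp => ((hfin.mem_toFinset).1 hp).1
  let F : Option (Finset (ℝ × ℝ)) → Set (ℝ × ℝ) := fun o => o.elim G fun S => convexHull ℝ S
  let E : Option (Finset (ℝ × ℝ)) → Finset (ℝ × ℝ) := fun o => o.elim S₀ id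
  have hEF : ∀ o, (E o : Set (ℝ × ℝ)) ⊆ F o := by
    rintro (_ | S)
    · intro p hp
      exact ((hfin.mem_toFinset).1 hp).2
    · exact subset_convexHull ℝ _
  have hmain : (⋂ o ∈ Finset.insertNone (coSmall P k), F o).Nonempty := by
    apply Convex.helly_theorem' (𝕜 := ℝ)
    · rintro (_ | S) _
      · exact hG
      · exact convex_convexHull ℝ _
    · intro I hI hIc
      have hIc3 : I.card ≤ 3 := by simpa using hIc
      have hsum : (I.biUnion fun o => P \ E o).card < P.card := by
        refine (Finset.card_biUnion_le).trans_lt ?_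
        have hs : ∀ o ∈ I.erase none, (P \ E o).card ≤ k := by
          rintro (_ | S) ho
          · simp at ho
          · have := hI (Finset.mem_of_mem_erase ho)
            obtain ⟨h1, h2⟩ := mem_coSmall.1 (Finset.some_mem_insertNone.1 this)
            have h3 : (P \ E (some S)).card = P.card - S.card := Finset.card_sdiff_of_subset h1
            omega
        have hs' := Finset.sum_le_card_nsmul _ _ _ hs
        rw [smul_eq_mul] at hs'
        by_cases hn : none ∈ I
        · rw [← Finset.add_sum_erase _ _ hn]
          rw [Finset.card_erase_of_mem hn] at hs'
          have h3 : (P \ E none).card = P.card - S₀.card := Finset.card_sdiff_of_subset hS₀P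
          have h4 : (I.card - 1) * k ≤ 2 * k := Nat.mul_le_mul_right k (by omega)
          omega
        · rw [Finset.erase_eq_of_notMem hn] at hs'
          have h4 : I.card * k ≤ 3 * k := Nat.mul_le_mul_right k hIc3
          omega
      obtain ⟨p, hp, hpI⟩ := Finset.exists_mem_notMem_of_card_lt_card hsum
      refine ⟨p, Set.mem_iInter₂.2 fun o ho => hEF o ?_⟩
      by_contra hpo
      exact hpI (Finset.mem_biUnion.2 ⟨o, ho, Finset.mem_sdiff.2 ⟨hp, hpo⟩⟩)
  obtain ⟨x, hx⟩ := hmain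
  rw [Set.mem_iInter₂] at hx
  refine ⟨x, hx none (Finset.none_mem_insertNone), ?_⟩
  rw [Dk_eq (by omega), Set.mem_iInter₂]
  exact fun S hS => hx (some S) (Finset.some_mem_insertNone.2 hS)

theorem Dk_nonempty (hk : 3 * k < P.card) : (Dk P k).Nonempty := by
  have := inter_Dk_nonempty hk (convex_univ (𝕜 := ℝ)) (by
    rw [Set.inter_univ, Set.ncard_coe_finset]
    omega)
  simpa using this

end ShallowHull

section Support

/-- The standard inner product on `ℝ × ℝ`. -/
def dot (u x : ℝ × ℝ) : ℝ := u.1 * x.1 + u.2 * x.2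

/-- The determinant of two vectors of `ℝ × ℝ`. -/
def cross (u v : ℝ × ℝ) : ℝ := u.1 * v.2 - u.2 * v.1

theorem dot_comb (a b x : ℝ × ℝ) (α β : ℝ) :
    dot (α • a + β • b) x = α * dot a x + β * dot b x := by
  simp [dot]
  ring

theorem dot_smul_left (c : ℝ) (u x : ℝ × ℝ) : dot (c • u) x = c * dot u x := by
  simp [dot]
  ring

theorem dot_add_smul (u x e : ℝ × ℝ) (s : ℝ) : dot u (x + s • e) = dot u x + s * dot u e := by
  simp [dot]
  ring

theorem continuous_dot (u : ℝ × ℝ) : Continuous (dot u) := by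
  unfold dot
  fun_prop

theorem eq_comb {a b : ℝ × ℝ} (h : cross a b ≠ 0) (z : ℝ × ℝ) :
    z = (cross z b / cross a b) • a + (cross a z / cross a b) • b := by
  ext <;> simp <;> field_simp <;> simp only [cross] <;> ring

theorem cross_comb (a b : ℝ × ℝ) (α β γ δ : ℝ) :
    cross (α • a + β • b) (γ • a + δ • b) = (α * δ - β * γ) * cross a b := by
  simp [cross]
  ring

theorem cross_self (a : ℝ × ℝ) : cross a a = 0 := by
  simp [cross]
  ring

theorem cross_swap (a b : ℝ × ℝ) : cross b a = -cross a b := by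
  simp [cross]
  ring

theorem ne_zero_of_cross_left {a b : ℝ × ℝ} (h : cross a b ≠ 0) : a ≠ 0 := by
  rintro rfl
  simp [cross] at h

theorem ne_zero_of_cross_right {a b : ℝ × ℝ} (h : cross a b ≠ 0) : b ≠ 0 := by
  rintro rfl
  simp [cross] at h

theorem dot_self_pos {u : ℝ × ℝ} (hu : u ≠ 0) : 0 < dot u u := by
  have : 0 ≤ dot u u := by
    unfold dot
    nlinarith [mul_self_nonneg u.1, mul_self_nonneg u.2]
  refine lt_of_le_of_ne this fun h => hu ?_
  unfold dot at h
  have h1 : u.1 = 0 := by nlinarith [mul_self_nonneg u.1, mul_self_nonneg u.2]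
  have h2 : u.2 = 0 := by nlinarith [mul_self_nonneg u.1, mul_self_nonneg u.2]
  exact Prod.ext h1 h2

/-- The open convex cone spanned by two vectors. -/
def openCone (a b : ℝ × ℝ) : Set (ℝ × ℝ) :=
  {z | ∃ α β : ℝ, 0 < α ∧ 0 < β ∧ z = α • a + β • b}

/-- The closed convex cone spanned by two vectors. -/
def closedCone (a b : ℝ × ℝ) : Set (ℝ × ℝ) :=
  {z | ∃ α β : ℝ, 0 ≤ α ∧ 0 ≤ β ∧ z = α • a + β • b}

theorem mem_openCone_iff {a b : ℝ × ℝ} (h : 0 < cross a b) {z : ℝ × ℝ} :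
    z ∈ openCone a b ↔ 0 < cross a z ∧ 0 < cross z b := by
  constructor
  · rintro ⟨α, β, hα, hβ, rfl⟩
    have h1 : cross a (α • a + β • b) = β * cross a b := by
      simp [cross]
      ring
    have h2 : cross (α • a + β • b) b = α * cross a b := by
      simp [cross]
      ring
    rw [h1, h2]
    exact ⟨mul_pos hβ h, mul_pos hα h⟩
  · rintro ⟨h1, h2⟩
    exact ⟨_, _, div_pos h2 h, div_pos h1 h, eq_comb h.ne' z⟩

theorem exists_pos_mul_lt {x y : ℝ} (hx : 0 < x) (hy : 0 < y) (α β : ℝ) :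
    ∃ ε, 0 < ε ∧ ε * α < x ∧ ε * β < y := by
  have hS : 0 < |α| + |β| + 1 := by positivity
  have key : ∀ γ z : ℝ, |γ| ≤ |α| + |β| → min x y ≤ z → min x y / (|α| + |β| + 1) * γ < z := by
    intro γ z h1 h2
    have h3 : 0 < min x y := lt_min hx hy
    calc min x y / (|α| + |β| + 1) * γ ≤ min x y / (|α| + |β| + 1) * |γ| := by
          gcongr
          exact le_abs_self γ
      _ < min x y / (|α| + |β| + 1) * (|α| + |β| + 1) := by
          gcongr
          linarith
      _ = min x y := by field_simp
      _ ≤ z := h2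
  exact ⟨min x y / (|α| + |β| + 1), by positivity,
    key _ _ (by linarith [abs_nonneg β]) (min_le_left _ _),
    key _ _ (by linarith [abs_nonneg α]) (min_le_right _ _)⟩

/-- `t u` is a point of `D` that is extreme in the direction `u`, chosen so that it depends only on
the ray spanned by `u`, and `D` is the intersection of its supporting halfplanes. -/
structure IsSupport (D : Set (ℝ × ℝ)) (t : ℝ × ℝ → ℝ × ℝ) : Prop where
  mem : ∀ u, t u ∈ D
  le : ∀ u, ∀ d ∈ D, dot u d ≤ dot u (t u)
  smul : ∀ (c : ℝ) (u), 0 < c → t (c • u) = t u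
  sep : ∀ x, x ∉ D → ∃ u, dot u (t u) < dot u x

/-- The signed excess of `x` over the supporting line in direction `u`. -/
def exc (t : ℝ × ℝ → ℝ × ℝ) (u x : ℝ × ℝ) : ℝ := dot u x - dot u (t u)

theorem exc_self (t : ℝ × ℝ → ℝ × ℝ) (u : ℝ × ℝ) : exc t u (t u) = 0 := sub_self _

theorem exc_add_smul (t : ℝ × ℝ → ℝ × ℝ) (u x e : ℝ × ℝ) (s : ℝ) :
    exc t u (x + s • e) = exc t u x + s * dot u e := by
  rw [exc, exc, dot_add_smul]
  ring

namespace IsSupport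

variable {D : Set (ℝ × ℝ)} {t : ℝ × ℝ → ℝ × ℝ}

theorem exc_nonpos (S : IsSupport D t) (u : ℝ × ℝ) {x : ℝ × ℝ} (hx : x ∈ D) : exc t u x ≤ 0 :=
  sub_nonpos.2 (S.le u x hx)

theorem exists_exc_pos (S : IsSupport D t) {x : ℝ × ℝ} (hx : x ∉ D) : ∃ u, 0 < exc t u x := by
  obtain ⟨u, hu⟩ := S.sep x hx
  exact ⟨u, sub_pos.2 hu⟩

theorem notMem (S : IsSupport D t) {u x : ℝ × ℝ} (h : 0 < exc t u x) : x ∉ D :=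
  fun hx => (S.exc_nonpos u hx).not_gt h

theorem exc_smul (S : IsSupport D t) {c : ℝ} (hc : 0 < c) (u x : ℝ × ℝ) :
    exc t (c • u) x = c * exc t u x := by
  rw [exc, exc, S.smul c u hc, dot_smul_left, dot_smul_left]
  ring

theorem exc_zero (t : ℝ × ℝ → ℝ × ℝ) (x : ℝ × ℝ) : exc t 0 x = 0 := by
  simp [exc, dot]

theorem exc_comb (S : IsSupport D t) {α β : ℝ} (hα : 0 ≤ α) (hβ : 0 ≤ β) (a b x : ℝ × ℝ) :
    α * exc t a x + β * exc t b x ≤ exc t (α • a + β • b) x := by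
  have h1 := mul_le_mul_of_nonneg_left (S.le a _ (S.mem (α • a + β • b))) hα
  have h2 := mul_le_mul_of_nonneg_left (S.le b _ (S.mem (α • a + β • b))) hβ
  simp only [exc, dot_comb]
  linarith

theorem exc_smul_nonneg (S : IsSupport D t) {c : ℝ} (hc : 0 ≤ c) (u x : ℝ × ℝ) :
    exc t (c • u) x = c * exc t u x := by
  rcases hc.eq_or_lt with rfl | hc
  · simp [exc_zero]
  · exact S.exc_smul hc u x

theorem exc_comb_three (S : IsSupport D t) {α β γ : ℝ} (hα : 0 ≤ α) (hβ : 0 ≤ β) (hγ : 0 ≤ γ)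
    (a b c x : ℝ × ℝ) :
    α * exc t a x + β * exc t b x + γ * exc t c x ≤ exc t (α • a + β • b + γ • c) x := by
  have h1 := S.exc_comb (zero_le_one) hγ (α • a + β • b) c x
  have h2 := S.exc_comb hα hβ a b x
  rw [one_smul] at h1
  linarith

/-- The directions in which `x` has nonnegative excess do not leave a cone through whose interior
they pass, if the excess is nonpositive on its boundary. -/
theorem mem_closedCone (S : IsSupport D t) {a b p z x : ℝ × ℝ} (hab : 0 < cross a b)
    (ha : exc t a x ≤ 0) (hb : exc t b x ≤ 0) (hp : p ∈ openCone a b) (hpx : 0 ≤ exc t p x)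
    (hzx : 0 ≤ exc t z x) (hpz : 0 < exc t p x + exc t z x) : z ∈ closedCone a b := by
  obtain ⟨p1, p2, hp1, hp2, rfl⟩ := hp
  obtain ⟨α, β, rfl⟩ : ∃ α β : ℝ, z = α • a + β • b := ⟨_, _, eq_comb hab.ne' z⟩
  set p := p1 • a + p2 • b with hp
  set z := α • a + β • b with hz
  have key1 : 0 ≤ p1 * β - α * p2 → 0 ≤ α := by
    intro h
    by_contra hα
    push Not at hα
    have h1 := S.exc_comb hp1.le (neg_pos.2 hα).le z p x
    have h2 : p1 • z + -α • p = (p1 * β - α * p2) • b := by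
      rw [hz, hp]
      module
    rw [h2, S.exc_smul_nonneg h] at h1
    have h3 := mul_nonpos_of_nonneg_of_nonpos h hb
    have h4 : 0 ≤ p1 * exc t z x := by positivity
    have h5 : 0 ≤ -α * exc t p x := mul_nonneg (by linarith) hpx
    have h6 : exc t z x = 0 := by
      have : p1 * exc t z x = 0 := by linarith
      simpa [hp1.ne'] using this
    have h7 : exc t p x = 0 := by
      have : -α * exc t p x = 0 := by linarith
      simpa [hα.ne] using this
    linarith
  have key2 : 0 ≤ p2 * α - β * p1 → 0 ≤ β := by
    intro h
    by_contra hβ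
    push Not at hβ
    have h1 := S.exc_comb hp2.le (neg_pos.2 hβ).le z p x
    have h2 : p2 • z + -β • p = (p2 * α - β * p1) • a := by
      rw [hz, hp]
      module
    rw [h2, S.exc_smul_nonneg h] at h1
    have h3 := mul_nonpos_of_nonneg_of_nonpos h ha
    have h4 : 0 ≤ p2 * exc t z x := by positivity
    have h5 : 0 ≤ -β * exc t p x := mul_nonneg (by linarith) hpx
    have h6 : exc t z x = 0 := by
      have : p2 * exc t z x = 0 := by linarith
      simpa [hp2.ne'] using this
    have h7 : exc t p x = 0 := by
      have : -β * exc t p x = 0 := by linarith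
      simpa [hβ.ne] using this
    linarith
  rcases le_total 0 (p1 * β - α * p2) with h | h
  · have h1 := key1 h
    refine ⟨α, β, h1, ?_, rfl⟩
    have : 0 ≤ p1 * β := by nlinarith
    exact nonneg_of_mul_nonneg_right this hp1
  · have h1 := key2 (by linarith)
    refine ⟨α, β, ?_, h1, rfl⟩
    have : 0 ≤ p2 * α := by nlinarith
    exact nonneg_of_mul_nonneg_right this hp2

theorem mem_openCone_of_mem_closedCone (S : IsSupport D t) {a b z x : ℝ × ℝ}
    (ha : exc t a x ≤ 0) (hb : exc t b x ≤ 0) (hz : z ∈ closedCone a b)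
    (hzx : 0 < exc t z x) : z ∈ openCone a b := by
  obtain ⟨α, β, hα, hβ, rfl⟩ := hz
  refine ⟨α, β, lt_of_le_of_ne hα fun h => ?_, lt_of_le_of_ne hβ fun h => ?_, rfl⟩
  · rw [← h, zero_smul, zero_add, S.exc_smul_nonneg hβ] at hzx
    nlinarith
  · rw [← h, zero_smul, add_zero, S.exc_smul_nonneg hα] at hzx
    nlinarith

theorem mem_openCone (S : IsSupport D t) {a b p z x : ℝ × ℝ} (hab : 0 < cross a b)
    (ha : exc t a x ≤ 0) (hb : exc t b x ≤ 0) (hp : p ∈ openCone a b) (hpx : 0 ≤ exc t p x)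
    (hzx : 0 < exc t z x) : z ∈ openCone a b :=
  S.mem_openCone_of_mem_closedCone ha hb
    (S.mem_closedCone hab ha hb hp hpx hzx.le (by linarith)) hzx

end IsSupport

end Support

section Cell

theorem exists_add_smul_mem_openCone {c d z : ℝ × ℝ} (hcd : cross c d ≠ 0)
    (hz : z ∈ openCone c d) (v : ℝ × ℝ) : ∃ ε : ℝ, 0 < ε ∧ z + ε • v ∈ openCone c d := by
  obtain ⟨γ, δ, hγ, hδ, rfl⟩ := hz
  obtain ⟨v1, v2, rfl⟩ : ∃ v1 v2 : ℝ, v = v1 • c + v2 • d := ⟨_, _, eq_comb hcd v⟩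
  obtain ⟨ε, hε, h1, h2⟩ := exists_pos_mul_lt hγ hδ (-v1) (-v2)
  refine ⟨ε, hε, γ + ε * v1, δ + ε * v2, by linarith, by linarith, by module⟩

theorem left_notMem_openCone {a b c d : ℝ × ℝ} (hcd : cross c d ≠ 0)
    (h : Disjoint (openCone a b) (openCone c d)) : a ∉ openCone c d := by
  intro ha
  obtain ⟨ε, hε, h1⟩ := exists_add_smul_mem_openCone hcd ha b
  exact Set.disjoint_left.1 h ⟨1, ε, one_pos, hε, by rw [one_smul]⟩ h1

theorem right_notMem_openCone {a b c d : ℝ × ℝ} (hcd : cross c d ≠ 0)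
    (h : Disjoint (openCone a b) (openCone c d)) : b ∉ openCone c d := by
  intro hb
  obtain ⟨ε, hε, h1⟩ := exists_add_smul_mem_openCone hcd hb a
  exact Set.disjoint_left.1 h ⟨ε, 1, hε, one_pos, by rw [one_smul, add_comm]⟩ h1

/-- The direction orthogonal to the chord from `t a` to `t b`, pointing away from the support. -/
def chordDir (t : ℝ × ℝ → ℝ × ℝ) (a b : ℝ × ℝ) : ℝ × ℝ :=
  -exc t b (t a) • a + -exc t a (t b) • b

/-- An affine function vanishing on the chord from `t a` to `t b`. -/
def chord (t : ℝ × ℝ → ℝ × ℝ) (a b x : ℝ × ℝ) : ℝ :=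
  -exc t b (t a) * exc t a x + -exc t a (t b) * exc t b x + exc t b (t a) * exc t a (t b)

theorem chord_sub (t : ℝ × ℝ → ℝ × ℝ) (a b x y : ℝ × ℝ) :
    chord t a b x - chord t a b y = dot (chordDir t a b) x - dot (chordDir t a b) y := by
  rw [chordDir, dot_comb, dot_comb]
  simp only [chord, exc]
  ring

theorem chord_left (t : ℝ × ℝ → ℝ × ℝ) (a b : ℝ × ℝ) : chord t a b (t a) = 0 := by
  rw [chord, exc_self]
  ring

theorem chord_right (t : ℝ × ℝ → ℝ × ℝ) (a b : ℝ × ℝ) : chord t a b (t b) = 0 := by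
  rw [chord, exc_self]
  ring

/-- The direction of the third side of a cell. -/
def wallDir (t : ℝ × ℝ → ℝ × ℝ) (a b : ℝ × ℝ) : Option (ℝ × ℝ) → ℝ × ℝ
  | none => chordDir t a b
  | some w => w

/-- The affine function defining the third side of a cell. -/
def wall (t : ℝ × ℝ → ℝ × ℝ) (a b : ℝ × ℝ) : Option (ℝ × ℝ) → ℝ × ℝ → ℝ
  | none => chord t a b
  | some w => exc t w

theorem wall_sub (t : ℝ × ℝ → ℝ × ℝ) (a b : ℝ × ℝ) (w : Option (ℝ × ℝ)) (x y : ℝ × ℝ) :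
    wall t a b w x - wall t a b w y = dot (wallDir t a b w) x - dot (wallDir t a b w) y := by
  cases w with
  | none => exact chord_sub t a b x y
  | some w =>
    simp only [wall, wallDir, exc]
    ring

theorem wall_add_smul (t : ℝ × ℝ → ℝ × ℝ) (a b : ℝ × ℝ) (w : Option (ℝ × ℝ)) (x e : ℝ × ℝ) (s : ℝ) :
    wall t a b w (x + s • e) = wall t a b w x + s * dot (wallDir t a b w) e := by
  have := wall_sub t a b w (x + s • e) x
  rw [dot_add_smul] at this
  linarith

/-- The region below the supporting lines in directions `a` and `b`, and above either the chord
between the corresponding extreme points, or the supporting line in direction `w`. -/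
def cell (t : ℝ × ℝ → ℝ × ℝ) (a b : ℝ × ℝ) (w : Option (ℝ × ℝ)) : Set (ℝ × ℝ) :=
  {x | exc t a x ≤ 0 ∧ exc t b x ≤ 0 ∧ 0 ≤ wall t a b w x}

/-- The conditions on the directions under which `cell t a b w` is used. -/
structure IsCell (t : ℝ × ℝ → ℝ × ℝ) (a b : ℝ × ℝ) (w : Option (ℝ × ℝ)) : Prop where
  cross_pos : 0 < cross a b
  cut : ∀ v ∈ w, v ∈ openCone a b
  wit : ∃ x μ, exc t a x ≤ 0 ∧ exc t b x ≤ 0 ∧ μ ∈ openCone a b ∧ 0 < exc t μ x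

variable {D : Set (ℝ × ℝ)} {t : ℝ × ℝ → ℝ × ℝ}

namespace IsSupport

theorem exc_comb_le_left (S : IsSupport D t) (α β : ℝ) (a b x : ℝ × ℝ) :
    exc t (α • a + β • b) x ≤ α * exc t a x + β * (exc t b x - exc t b (t a)) := by
  have := S.le (α • a + β • b) _ (S.mem a)
  simp only [exc, dot_comb] at *
  linarith

theorem exc_comb_le_right (S : IsSupport D t) (α β : ℝ) (a b x : ℝ × ℝ) :
    exc t (α • a + β • b) x ≤ α * (exc t a x - exc t a (t b)) + β * exc t b x := by
  have := S.le (α • a + β • b) _ (S.mem b)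
  simp only [exc, dot_comb] at *
  linarith

theorem exc_lt_of_mem_openCone (S : IsSupport D t) {a b μ x : ℝ × ℝ}
    (ha : exc t a x ≤ 0) (hb : exc t b x ≤ 0) (hμ : μ ∈ openCone a b) (hx : 0 < exc t μ x) :
    exc t a (t b) < exc t a x ∧ exc t b (t a) < exc t b x ∧ 0 ≤ chord t a b x := by
  obtain ⟨α, β, hα, hβ, rfl⟩ := hμ
  have h1 := S.exc_comb_le_left α β a b x
  have h2 := S.exc_comb_le_right α β a b x
  have h3 : 0 < exc t a x - exc t a (t b) := by
    refine pos_of_mul_pos_right ?_ hα.le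
    nlinarith
  have h4 : 0 < exc t b x - exc t b (t a) := by
    refine pos_of_mul_pos_right ?_ hβ.le
    nlinarith
  refine ⟨by linarith, by linarith, nonneg_of_mul_nonneg_right (a := β) ?_ hβ⟩
  have h5 : β * chord t a b x =
      (α * exc t a x + β * (exc t b x - exc t b (t a))) * (exc t a x - exc t a (t b)) +
      (α * (exc t a x - exc t a (t b)) + β * exc t b x) * (-exc t a x) := by
    rw [chord]
    ring
  rw [h5]
  have h6 := mul_nonneg (hx.le.trans h1) h3.le
  have h7 := mul_nonneg (hx.le.trans h2) (neg_nonneg.2 ha)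
  linarith

/-- The coefficients of a direction in which a point above a chord has large excess. -/
theorem le_mul_chord (S : IsSupport D t) {a b x : ℝ × ℝ}
    (hr : exc t a (t b) < 0) (hq : exc t b (t a) < 0)
    (ha : exc t a x ≤ 0) (hb : exc t b x ≤ 0) (hG : 0 ≤ chord t a b x) (α β : ℝ) :
    -exc t b (t a) * exc t (α • a + β • b) x ≤ α * chord t a b x ∧
      -exc t a (t b) * exc t (α • a + β • b) x ≤ β * chord t a b x := by
  have h1 := S.exc_comb_le_left α β a b x
  have h2 := S.exc_comb_le_right α β a b x
  have hG' := hG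
  rw [chord] at hG'
  have h3 : 0 ≤ exc t a x - exc t a (t b) := by
    refine nonneg_of_mul_nonneg_right (a := -exc t b (t a)) ?_ (by linarith)
    nlinarith
  have h4 : 0 ≤ exc t b x - exc t b (t a) := by
    refine nonneg_of_mul_nonneg_right (a := -exc t a (t b)) ?_ (by linarith)
    nlinarith
  have h5 : β * chord t a b x =
      (α * exc t a x + β * (exc t b x - exc t b (t a))) * (exc t a x - exc t a (t b)) +
      (α * (exc t a x - exc t a (t b)) + β * exc t b x) * (-exc t a x) := by
    rw [chord]
    ring
  have h6 : α * chord t a b x =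
      (α * exc t a x + β * (exc t b x - exc t b (t a))) * (-exc t b x) +
      (α * (exc t a x - exc t a (t b)) + β * exc t b x) * (exc t b x - exc t b (t a)) := by
    rw [chord]
    ring
  rw [h5, h6]
  have h7 := mul_le_mul_of_nonneg_right h1 h3
  have h8 := mul_le_mul_of_nonneg_right h2 (neg_nonneg.2 ha)
  have h9 := mul_le_mul_of_nonneg_right h1 (neg_nonneg.2 hb)
  have h10 := mul_le_mul_of_nonneg_right h2 h4
  constructor <;> linarith

end IsSupport

namespace IsCell

variable {a b c d : ℝ × ℝ} {w v : Option (ℝ × ℝ)}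

theorem exc_neg (h : IsCell t a b w) (S : IsSupport D t) :
    exc t a (t b) < 0 ∧ exc t b (t a) < 0 := by
  obtain ⟨x, μ, ha, hb, hμ, hx⟩ := h.wit
  obtain ⟨h1, h2, -⟩ := S.exc_lt_of_mem_openCone ha hb hμ hx
  exact ⟨h1.trans_le ha, h2.trans_le hb⟩

theorem wallDir_mem (h : IsCell t a b w) (S : IsSupport D t) : wallDir t a b w ∈ openCone a b := by
  cases w with
  | none =>
    obtain ⟨h1, h2⟩ := h.exc_neg S
    exact ⟨_, _, neg_pos.2 h2, neg_pos.2 h1, rfl⟩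
  | some w => exact h.cut w rfl

theorem wallDir_ne_zero (h : IsCell t a b w) (S : IsSupport D t) : wallDir t a b w ≠ 0 :=
  ne_zero_of_cross_left ((mem_openCone_iff h.cross_pos).1 (h.wallDir_mem S)).2.ne'

theorem left_ne_zero (h : IsCell t a b w) : a ≠ 0 := ne_zero_of_cross_left h.cross_pos.ne'

theorem right_ne_zero (h : IsCell t a b w) : b ≠ 0 := ne_zero_of_cross_right h.cross_pos.ne'

/-- The directions of nonnegative excess of a point of the cell outside the support. -/
theorem exists_exc_pos (h : IsCell t a b w) (S : IsSupport D t) {x : ℝ × ℝ}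
    (hx : x ∈ cell t a b w) (hxD : x ∉ D) : ∃ μ ∈ openCone a b, 0 < exc t μ x := by
  obtain ⟨μ, hμ⟩ := S.exists_exc_pos hxD
  obtain ⟨ha, hb, hw⟩ := hx
  refine ⟨μ, ?_, hμ⟩
  cases w with
  | none =>
    obtain ⟨h1, h2⟩ := h.exc_neg S
    obtain ⟨α, β, rfl⟩ : ∃ α β : ℝ, μ = α • a + β • b := ⟨_, _, eq_comb h.cross_pos.ne' μ⟩
    obtain ⟨h3, h4⟩ := S.le_mul_chord h1 h2 ha hb hw α β
    have h5 := mul_pos (neg_pos.2 h2) hμ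
    have h6 := mul_pos (neg_pos.2 h1) hμ
    exact ⟨α, β, pos_of_mul_pos_left (h5.trans_le h3) hw,
      pos_of_mul_pos_left (h6.trans_le h4) hw, rfl⟩
  | some w => exact S.mem_openCone h.cross_pos ha hb (h.cut w rfl) hw hμ

theorem mem_closedCone (h : IsCell t a b w) (S : IsSupport D t) {x z : ℝ × ℝ}
    (hx : x ∈ cell t a b w) (hxD : x ∉ D) (hz : 0 ≤ exc t z x) : z ∈ closedCone a b := by
  obtain ⟨μ, hμ, hμx⟩ := h.exists_exc_pos S hx hxD
  exact S.mem_closedCone h.cross_pos hx.1 hx.2.1 hμ hμx.le hz (by linarith)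

theorem mem_openCone (h : IsCell t a b w) (S : IsSupport D t) {x z : ℝ × ℝ}
    (hx : x ∈ cell t a b w) (hxD : x ∉ D) (hz : 0 < exc t z x) : z ∈ openCone a b :=
  S.mem_openCone_of_mem_closedCone hx.1 hx.2.1 (h.mem_closedCone S hx hxD hz.le) hz

/-- The extreme point in a direction outside the cone does not lie above the chord. -/
theorem chord_nonpos (h : IsCell t a b none) (S : IsSupport D t) {u : ℝ × ℝ} (hu : u ≠ 0)
    (hu' : u ∉ openCone a b) : chord t a b (t u) ≤ 0 := by
  by_contra! hG
  obtain ⟨h1, h2⟩ := h.exc_neg S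
  obtain ⟨α, β, rfl⟩ : ∃ α β : ℝ, u = α • a + β • b := ⟨_, _, eq_comb h.cross_pos.ne' u⟩
  obtain ⟨h3, h4⟩ := S.le_mul_chord h1 h2 (S.exc_nonpos a (S.mem (α • a + β • b)))
    (S.exc_nonpos b (S.mem (α • a + β • b))) hG.le α β
  rw [exc_self, mul_zero] at h3 h4
  have h5 := nonneg_of_mul_nonneg_left h3 hG
  have h6 := nonneg_of_mul_nonneg_left h4 hG
  rcases h5.eq_or_lt with rfl | h5
  · rcases h6.eq_or_lt with rfl | h6
    · simp at hu
    · rw [zero_smul, zero_add, S.smul _ _ h6, chord_right] at hG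
      exact hG.false
  · rcases h6.eq_or_lt with rfl | h6
    · rw [zero_smul, add_zero, S.smul _ _ h5, chord_left] at hG
      exact hG.false
    · exact hu' ⟨α, β, h5, h6, rfl⟩

theorem cross_chordDir_nonpos (h : IsCell t a b none) (h' : IsCell t c d none) (S : IsSupport D t)
    (hdisj : Disjoint (openCone a b) (openCone c d)) {x : ℝ × ℝ} (hb : exc t b x ≤ 0)
    (hx : 0 < chord t a b x) (hx' : 0 < chord t c d x) :
    cross (chordDir t a b) (chordDir t c d) ≤ 0 := by
  by_contra! hW
  obtain ⟨h1, h2⟩ := h.exc_neg S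
  have hW1b : 0 < cross (chordDir t a b) b := by
    have := cross_comb a b (-exc t b (t a)) (-exc t a (t b)) 0 1
    rw [zero_smul, one_smul, zero_add] at this
    rw [chordDir, this]
    have := mul_pos (neg_pos.2 h2) h.cross_pos
    linarith
  have hW2 : chordDir t c d ∈ openCone c d := h'.wallDir_mem S
  have hbW2 : 0 ≤ cross b (chordDir t c d) := by
    by_contra! hlt
    refine Set.disjoint_left.1 hdisj ?_ hW2
    rw [eq_comb hW1b.ne' (chordDir t c d)]
    have h3 : 0 < cross (chordDir t c d) b / cross (chordDir t a b) b := by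
      refine div_pos ?_ hW1b
      rw [cross_swap]
      linarith
    have h4 := div_pos hW hW1b
    obtain ⟨α, β, hα, hβ, h5⟩ := h.wallDir_mem S
    refine ⟨cross (chordDir t c d) b / cross (chordDir t a b) b * α,
      cross (chordDir t c d) b / cross (chordDir t a b) b * β +
        cross (chordDir t a b) (chordDir t c d) / cross (chordDir t a b) b,
      by positivity, by positivity, ?_⟩
    conv_lhs => enter [1, 2]; rw [show chordDir t a b = _ from h5]
    module
  have h3 := h'.chord_nonpos S h.right_ne_zero (right_notMem_openCone h'.cross_pos.ne' hdisj)
  have h4 := chord_sub t a b x (t b)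
  have h5 := chord_sub t c d x (t b)
  rw [chord_right] at h4
  have h6 := dot_comb (chordDir t a b) (chordDir t c d) x
    (cross b (chordDir t c d) / cross (chordDir t a b) (chordDir t c d))
    (cross (chordDir t a b) b / cross (chordDir t a b) (chordDir t c d))
  have h7 := dot_comb (chordDir t a b) (chordDir t c d) (t b)
    (cross b (chordDir t c d) / cross (chordDir t a b) (chordDir t c d))
    (cross (chordDir t a b) b / cross (chordDir t a b) (chordDir t c d))
  rw [← eq_comb hW.ne' b] at h6 h7
  have h8 := div_pos hW1b hW
  have h9 := div_nonneg hbW2 hW.le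
  have h10 := mul_nonneg h9 (by linarith :
    0 ≤ dot (chordDir t a b) x - dot (chordDir t a b) (t b))
  have h11 := mul_pos h8 (by linarith :
    0 < dot (chordDir t c d) x - dot (chordDir t c d) (t b))
  rw [exc] at hb
  linarith

theorem chord_false (h : IsCell t a b none) (h' : IsCell t c d none) (S : IsSupport D t)
    (hdisj : Disjoint (openCone a b) (openCone c d)) {x : ℝ × ℝ} (hb : exc t b x ≤ 0)
    (hd : exc t d x ≤ 0) (hx : 0 < chord t a b x) (hx' : 0 < chord t c d x) : False := by
  have h1 := h.cross_chordDir_nonpos h' S hdisj hb hx hx'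
  have h2 := h'.cross_chordDir_nonpos h S hdisj.symm hd hx' hx
  rw [cross_swap] at h2
  have h3 : cross (chordDir t a b) (chordDir t c d) = 0 := by linarith
  obtain ⟨hr, hq⟩ := h.exc_neg S
  obtain ⟨α, β, h4⟩ : ∃ α β : ℝ, chordDir t c d = α • a + β • b := ⟨_, _, eq_comb h.cross_pos.ne' _⟩
  have hW2 : chordDir t c d ∈ openCone c d := h'.wallDir_mem S
  have h5 : -exc t b (t a) * β = -exc t a (t b) * α := by
    rw [h4, chordDir, cross_comb] at h3
    have := (mul_eq_zero.1 h3).resolve_right h.cross_pos.ne'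
    linarith
  have h6 : -exc t b (t a) • chordDir t c d = α • chordDir t a b := by
    rw [h4, chordDir]
    simp only [smul_add, smul_smul]
    rw [h5, mul_comm α, mul_comm α]
  have h7 : α ≤ 0 := by
    by_contra! hα
    refine Set.disjoint_left.1 hdisj ?_ hW2
    refine ⟨α, β, hα, ?_, h4⟩
    refine pos_of_mul_pos_right (h5 ▸ ?_) (neg_nonneg.2 hq.le)
    exact mul_pos (neg_pos.2 hr) hα
  have h8 := h.chord_nonpos S h'.left_ne_zero (left_notMem_openCone h.cross_pos.ne' hdisj.symm)
  have h9 := chord_sub t a b x (t c)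
  have h10 := chord_sub t c d x (t c)
  rw [chord_left] at h10
  have h11 := congrArg (fun u => dot u x - dot u (t c)) h6
  simp only [dot_smul_left] at h11
  nlinarith

end IsCell

theorem lt_of_mem_interior {K : Set (ℝ × ℝ)} {f : ℝ × ℝ → ℝ} {e : ℝ × ℝ} {m : ℝ}
    (hf : ∀ (x : ℝ × ℝ) (s : ℝ), f (x + s • e) = f x + s * m) (hm : 0 < m)
    (hK : ∀ x ∈ K, f x ≤ 0) {x : ℝ × ℝ} (hx : x ∈ interior K) : f x < 0 := by
  have hc : Filter.Tendsto (fun s : ℝ => x + s • e) (nhdsWithin 0 (Set.Ioi 0)) (nhds x) := by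
    have : Continuous fun s : ℝ => x + s • e := by fun_prop
    have := this.tendsto 0
    rw [zero_smul, add_zero] at this
    exact this.mono_left nhdsWithin_le_nhds
  obtain ⟨s, hs, hs0⟩ := ((hc.eventually (mem_interior_iff_mem_nhds.1 hx)).and
    self_mem_nhdsWithin).exists
  have h1 := hK _ hs
  rw [hf] at h1
  have := mul_pos hs0 hm
  linarith

namespace IsCell

variable {a b c d : ℝ × ℝ} {w v : Option (ℝ × ℝ)}

theorem wall_pos_of_mem_interior (h : IsCell t a b w) (S : IsSupport D t) {x : ℝ × ℝ}
    (hx : x ∈ interior (cell t a b w)) : 0 < wall t a b w x := by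
  have := lt_of_mem_interior (f := fun x => -wall t a b w x) (e := (-1 : ℝ) • wallDir t a b w)
    (m := dot (wallDir t a b w) (wallDir t a b w)) (fun x s => ?_)
    (dot_self_pos (h.wallDir_ne_zero S)) (fun x hx => neg_nonpos.2 hx.2.2) hx
  · linarith
  · rw [smul_smul, wall_add_smul]
    ring

theorem interior_inter (h : IsCell t a b w) (h' : IsCell t c d v) (S : IsSupport D t)
    (hsep : Disjoint (openCone a b) (openCone c d) ∨ (∃ z ∈ w, z ∉ openCone c d) ∨
      ∃ z ∈ v, z ∉ openCone a b) :
    interior (cell t a b w) ∩ interior (cell t c d v) = ∅ := by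
  rw [Set.eq_empty_iff_forall_notMem]
  rintro x ⟨hx, hx'⟩
  have h1 := h.wall_pos_of_mem_interior S hx
  have h2 := h'.wall_pos_of_mem_interior S hx'
  replace hx := interior_subset hx
  replace hx' := interior_subset hx'
  by_cases hxD : x ∈ D
  · cases w with
    | some w => exact S.notMem h1 hxD
    | none =>
      cases v with
      | some v => exact S.notMem h2 hxD
      | none =>
        refine h.chord_false h' S ?_ hx.2.1 hx'.2.1 h1 h2
        simpa using hsep
  · rcases hsep with hsep | ⟨z, rfl, hz⟩ | ⟨z, rfl, hz⟩
    · obtain ⟨μ, hμ, hμx⟩ := h.exists_exc_pos S hx hxD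
      exact Set.disjoint_left.1 hsep hμ (h'.mem_openCone S hx' hxD hμx)
    · exact hz (h'.mem_openCone S hx' hxD h1)
    · exact hz (h.mem_openCone S hx hxD h2)

end IsCell

end Cell

section Line

/-- A set closed under nonnegative combinations. -/
def IsCone (J : Set (ℝ × ℝ)) : Prop :=
  ∀ z ∈ J, ∀ z' ∈ J, ∀ α β : ℝ, 0 ≤ α → 0 ≤ β → α • z + β • z' ∈ J

/-- `J` contains a direction between `a` and `b`, but not both `a` and `b`. -/
def MeetsCone (J : Set (ℝ × ℝ)) (a b : ℝ × ℝ) : Prop :=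
  (∃ z ∈ J, z ≠ 0 ∧ z ∈ closedCone a b) ∧ ¬ (a ∈ J ∧ b ∈ J)

/-- The closed ray spanned by `u`. -/
def ray (u : ℝ × ℝ) : Set (ℝ × ℝ) := {z | ∃ s : ℝ, 0 ≤ s ∧ z = s • u}

theorem isCone_ray (u : ℝ × ℝ) : IsCone (ray u) := by
  rintro _ ⟨s, hs, rfl⟩ _ ⟨s', hs', rfl⟩ α β hα hβ
  exact ⟨α * s + β * s', by positivity, by module⟩

theorem left_mem_closedCone (a b : ℝ × ℝ) : a ∈ closedCone a b :=
  ⟨1, 0, zero_le_one, le_rfl, by simp⟩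

theorem right_mem_closedCone (a b : ℝ × ℝ) : b ∈ closedCone a b :=
  ⟨0, 1, le_rfl, zero_le_one, by simp⟩

variable {D : Set (ℝ × ℝ)} {t : ℝ × ℝ → ℝ × ℝ}

theorem IsSupport.isCone_setOf_exc_nonneg (S : IsSupport D t) (y : ℝ × ℝ) :
    IsCone {u | 0 ≤ exc t u y} := by
  intro z hz z' hz' α β hα hβ
  exact (add_nonneg (mul_nonneg hα hz) (mul_nonneg hβ hz')).trans (S.exc_comb hα hβ z z' y)

theorem IsCell.meetsCone_ray {a b u : ℝ × ℝ} {w : Option (ℝ × ℝ)} (h : IsCell t a b w)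
    (hu : u ≠ 0) (hu' : u ∈ closedCone a b) : MeetsCone (ray u) a b := by
  refine ⟨⟨u, ⟨1, zero_le_one, (one_smul ℝ u).symm⟩, hu, hu'⟩, ?_⟩
  rintro ⟨⟨s, -, rfl⟩, ⟨s', -, rfl⟩⟩
  have := h.cross_pos
  simp only [cross, Prod.smul_fst, Prod.smul_snd, smul_eq_mul] at this
  linarith

theorem IsCell.meetsCone_setOf_exc_nonneg {a b y : ℝ × ℝ} {w : Option (ℝ × ℝ)} (h : IsCell t a b w)
    (S : IsSupport D t) (hy : y ∈ D) (hab : 0 ≤ exc t a y ∨ 0 ≤ exc t b y) :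
    MeetsCone {u | 0 ≤ exc t u y} a b := by
  constructor
  · rcases hab with hab | hab
    · exact ⟨a, hab, h.left_ne_zero, left_mem_closedCone a b⟩
    · exact ⟨b, hab, h.right_ne_zero, right_mem_closedCone a b⟩
  · rintro ⟨ha, hb⟩
    obtain ⟨x, _, hax, hbx, ⟨α, β, hα, hβ, rfl⟩, hx⟩ := h.wit
    have h1 := S.le (α • a + β • b) y hy
    have h2 : 0 ≤ α * exc t a y := mul_nonneg hα.le ha
    have h3 : 0 ≤ β * exc t b y := mul_nonneg hβ.le hb
    have h4 := mul_nonpos_of_nonneg_of_nonpos hα.le hax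
    have h5 := mul_nonpos_of_nonneg_of_nonpos hβ.le hbx
    simp only [exc, dot_comb] at *
    linarith

/-- If `D` contains no point beyond `y` in direction `e`, then it has a supporting line through `y`
bounding it in that direction. -/
theorem IsSupport.exists_dir (S : IsSupport D t) {y e : ℝ × ℝ} (hy : y ∈ D)
    (h : ∀ ε : ℝ, 0 < ε → y + ε • e ∉ D) : ∃ u, u ≠ 0 ∧ 0 ≤ exc t u y ∧ 0 ≤ dot u e := by
  have h1 : ∀ m : ℕ, ∃ u : ℝ × ℝ, u ∈ Metric.sphere (0 : ℝ × ℝ) 1 ∧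
      0 < exc t u (y + (1 / ((m : ℝ) + 1)) • e) := by
    intro m
    obtain ⟨u, hu⟩ := S.exists_exc_pos (h (1 / ((m : ℝ) + 1)) (by positivity))
    have hu0 : u ≠ 0 := by
      rintro rfl
      rw [exc_zero] at hu
      exact hu.false
    have hn : 0 < ‖u‖⁻¹ := inv_pos.2 (norm_pos_iff.2 hu0)
    refine ⟨‖u‖⁻¹ • u, ?_, ?_⟩
    · simp [norm_smul, hu0]
    · rw [S.exc_smul hn]
      exact mul_pos hn hu
  choose v hv hvy using h1
  obtain ⟨u, hu, φ, hφ, hlim⟩ := (isCompact_sphere (0 : ℝ × ℝ) 1).tendsto_subseq hv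
  have hdot : ∀ z : ℝ × ℝ,
      Filter.Tendsto (fun m => dot (v (φ m)) z) Filter.atTop (nhds (dot u z)) := by
    intro z
    have : Continuous fun u : ℝ × ℝ => dot u z := by
      unfold dot
      fun_prop
    exact (this.tendsto u).comp hlim
  have hpos : ∀ m, 0 ≤ dot (v m) e := by
    intro m
    have h2 := hvy m
    rw [exc_add_smul] at h2
    have h3 := S.exc_nonpos (v m) hy
    exact nonneg_of_mul_nonneg_right (by linarith) (by positivity : 0 < 1 / ((m : ℝ) + 1))
  refine ⟨u, ?_, ?_, ?_⟩
  · rintro rfl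
    simp at hu
  · have h4 : ∀ m, dot (v (φ m)) (t u) ≤ dot (v (φ m)) y + 1 / ((m : ℝ) + 1) * dot (v (φ m)) e := by
      intro m
      have h2 := (hvy (φ m)).le
      rw [exc_add_smul, exc] at h2
      have h3 := S.le (v (φ m)) _ (S.mem u)
      have h5 : 1 / ((φ m : ℝ) + 1) ≤ 1 / ((m : ℝ) + 1) := by
        have : (m : ℝ) ≤ φ m := by exact_mod_cast hφ.id_le m
        gcongr
      have h6 := mul_le_mul_of_nonneg_right h5 (hpos (φ m))
      linarith
    have h5 := (hdot y).add (tendsto_one_div_add_atTop_nhds_zero_nat.mul (hdot e))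
    have h6 := le_of_tendsto_of_tendsto' (hdot (t u)) h5 h4
    rw [exc]
    linarith
  · exact ge_of_tendsto' (hdot e) fun m => hpos (φ m)

/-- The two sets of directions attached to the end `y` of a chord of `D`. -/
theorem IsSupport.exists_isCone_of_end (S : IsSupport D t) {y e : ℝ × ℝ} (hy : y ∈ D)
    (h : ∀ ε : ℝ, 0 < ε → y + ε • e ∉ D) :
    ∃ J J' : Set (ℝ × ℝ), IsCone J ∧ IsCone J' ∧ ∀ a b w, IsCell t a b w → ∀ s : ℝ,
      (0 < s ∧ y + s • e ∈ cell t a b w ∨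
        s ≤ 0 ∧ 0 ≤ dot (wallDir t a b w) e ∧ y + s • e ∈ cell t a b w) →
      MeetsCone J a b ∨ MeetsCone J' a b := by
  obtain ⟨u, hu, huy, hue⟩ := S.exists_dir hy h
  refine ⟨ray u, {v | 0 ≤ exc t v y}, isCone_ray u, S.isCone_setOf_exc_nonneg y, ?_⟩
  intro a b w hc s hs
  have key : ∀ s : ℝ, 0 < s → y + s • e ∈ cell t a b w → MeetsCone (ray u) a b := by
    intro s hs hx
    refine hc.meetsCone_ray hu (hc.mem_closedCone S hx (h s hs) ?_)
    rw [exc_add_smul]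
    positivity
  rcases hs with ⟨hs, hx⟩ | ⟨hs, hwe, -, -, hx⟩
  · exact Or.inl (key s hs hx)
  · by_cases hab : 0 ≤ exc t a y ∨ 0 ≤ exc t b y
    · exact Or.inr (hc.meetsCone_setOf_exc_nonneg S hy hab)
    · push Not at hab
      obtain ⟨ε, hε, h1, h2⟩ := exists_pos_mul_lt (neg_pos.2 hab.1) (neg_pos.2 hab.2)
        (dot a e) (dot b e)
      refine Or.inl (key ε hε ⟨?_, ?_, ?_⟩)
      · rw [exc_add_smul]
        linarith
      · rw [exc_add_smul]
        linarith
      · rw [wall_add_smul] at hx ⊢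
        have := mul_nonneg (by linarith : 0 ≤ ε - s) hwe
        linarith

theorem exists_eq_add_smul {n x y : ℝ × ℝ} (hn : n ≠ 0) (h : dot n x = dot n y) :
    ∃ s : ℝ, x = y + s • (-n.2, n.1) := by
  have hp : n.1 ^ 2 + n.2 ^ 2 ≠ 0 := by
    have := (dot_self_pos hn).ne'
    rwa [dot, ← sq, ← sq] at this
  unfold dot at h
  refine ⟨(n.1 * (x.2 - y.2) - n.2 * (x.1 - y.1)) / (n.1 ^ 2 + n.2 ^ 2), ?_⟩
  ext
  · simp only [Prod.fst_add, Prod.smul_fst, smul_eq_mul]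
    field_simp
    linear_combination n.1 * h
  · simp only [Prod.snd_add, Prod.smul_snd, smul_eq_mul]
    field_simp
    linear_combination n.2 * h

theorem exists_mem_dot_eq (hDc : Convex ℝ D) {n x y : ℝ × ℝ} {m : ℝ} (hx : x ∈ D) (hy : y ∈ D)
    (hxm : dot n x ≤ m) (hym : m ≤ dot n y) : ∃ z ∈ D, dot n z = m := by
  have h1 := hDc.isPreconnected.image (dot n) (continuous_dot n).continuousOn
  exact h1.ordConnected.out (Set.mem_image_of_mem _ hx) (Set.mem_image_of_mem _ hy) ⟨hxm, hym⟩

theorem exists_end (hD : IsCompact D) {n : ℝ × ℝ} {m : ℝ} (h : ∃ z ∈ D, dot n z = m) {e : ℝ × ℝ}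
    (he : e ≠ 0) (hne : dot n e = 0) :
    ∃ y ∈ D, dot n y = m ∧ ∀ ε : ℝ, 0 < ε → y + ε • e ∉ D := by
  have hK : IsCompact (D ∩ {z | dot n z = m}) :=
    hD.inter_right (isClosed_eq (continuous_dot n) continuous_const)
  obtain ⟨z, hz, hzm⟩ := h
  obtain ⟨y, ⟨hy, hym⟩, hmax⟩ := hK.exists_isMaxOn ⟨z, hz, hzm⟩ (continuous_dot e).continuousOn
  refine ⟨y, hy, hym, fun ε hε hc => ?_⟩
  have h1 : dot n (y + ε • e) = m := by
    rw [dot_add_smul, hne, mul_zero, add_zero]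
    exact hym
  have h2 : dot e (y + ε • e) ≤ dot e y := hmax ⟨hc, h1⟩
  rw [dot_add_smul] at h2
  have := mul_pos hε (dot_self_pos he)
  linarith

/-- The directions of the cells met by a line are controlled by four convex cones. -/
theorem IsSupport.exists_isCone_of_line (S : IsSupport D t) (hD : IsCompact D) (hDc : Convex ℝ D)
    {n : ℝ × ℝ} (hn : n ≠ 0) (m : ℝ) :
    ∃ J : Fin 4 → Set (ℝ × ℝ), (∀ j, IsCone (J j)) ∧ ∀ a b w, IsCell t a b w →
      ∀ x ∈ cell t a b w, dot n x = m → ∃ j, MeetsCone (J j) a b := by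
  have hempty : ∀ u : ℝ × ℝ, u ≠ 0 → (∀ x, dot n x = m → 0 < exc t u x) →
      ∃ J : Fin 4 → Set (ℝ × ℝ), (∀ j, IsCone (J j)) ∧ ∀ a b w, IsCell t a b w →
        ∀ x ∈ cell t a b w, dot n x = m → ∃ j, MeetsCone (J j) a b := by
    intro u hu h
    refine ⟨fun _ => ray u, fun _ => isCone_ray u, fun a b w hc x hx hxm => ⟨0, ?_⟩⟩
    have h1 := h x hxm
    exact hc.meetsCone_ray hu (hc.mem_closedCone S hx (S.notMem h1) h1.le)
  rcases lt_or_ge (dot n (t n)) m with h1 | h1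
  · exact hempty n hn fun x hx => by rw [exc]; linarith
  rcases lt_or_ge m (dot n (t (-n))) with h2 | h2
  · refine hempty (-n) (neg_ne_zero.2 hn) fun x hx => ?_
    simp only [exc, dot, Prod.fst_neg, Prod.snd_neg] at *
    linarith
  have hex := exists_mem_dot_eq hDc (S.mem _) (S.mem _) h2 h1
  set e : ℝ × ℝ := (-n.2, n.1) with he_def
  have he : e ≠ 0 := by
    intro he
    simp only [he_def, Prod.mk_eq_zero, neg_eq_zero] at he
    exact hn (Prod.ext he.2 he.1)
  have hne : dot n e = 0 := by
    simp only [dot, he_def]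
    ring
  have hne' : dot n (-e) = 0 := by
    simp only [dot, he_def, Prod.fst_neg, Prod.snd_neg]
    ring
  obtain ⟨y, hy, hym, hyD⟩ := exists_end hD hex he hne
  obtain ⟨y', hy', hym', hyD'⟩ := exists_end hD hex (neg_ne_zero.2 he) hne'
  obtain ⟨J0, J1, hJ0, hJ1, hJ⟩ := S.exists_isCone_of_end hy hyD
  obtain ⟨J2, J3, hJ2, hJ3, hJ'⟩ := S.exists_isCone_of_end hy' hyD'
  refine ⟨![J0, J1, J2, J3], ?_, ?_⟩
  · intro j
    fin_cases j <;> assumption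
  intro a b w hc x hx hxm
  suffices h : (MeetsCone J0 a b ∨ MeetsCone J1 a b) ∨ MeetsCone J2 a b ∨ MeetsCone J3 a b by
    rcases h with (h | h) | h | h
    exacts [⟨0, h⟩, ⟨1, h⟩, ⟨2, h⟩, ⟨3, h⟩]
  obtain ⟨s, hs⟩ := exists_eq_add_smul hn (hxm.trans hym.symm)
  obtain ⟨s', hs'⟩ := exists_eq_add_smul hn (hxm.trans hym'.symm)
  rw [← he_def] at hs hs'
  have hs'' : x = y' + (-s') • -e := by rw [hs', smul_neg, neg_smul, neg_neg]
  rcases lt_or_ge 0 s with h3 | h3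
  · exact Or.inl (hJ a b w hc s (Or.inl ⟨h3, hs ▸ hx⟩))
  rcases lt_or_ge 0 (-s') with h4 | h4
  · exact Or.inr (hJ' a b w hc (-s') (Or.inl ⟨h4, hs'' ▸ hx⟩))
  rcases le_total 0 (dot (wallDir t a b w) e) with h5 | h5
  · exact Or.inl (hJ a b w hc s (Or.inr ⟨h3, h5, hs ▸ hx⟩))
  · refine Or.inr (hJ' a b w hc (-s') (Or.inr ⟨h4, ?_, hs'' ▸ hx⟩))
    simp only [dot, Prod.fst_neg, Prod.snd_neg] at *
    linarith

end Line

section Existence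

theorem exists_isSupport {D : Set (ℝ × ℝ)} (hD : IsCompact D) (hne : D.Nonempty)
    (hsep : ∀ x, x ∉ D → ∃ u c, (∀ d ∈ D, dot u d ≤ c) ∧ c < dot u x) : ∃ t, IsSupport D t := by
  let A : ℝ × ℝ → Set (ℝ × ℝ) := fun u => {x | x ∈ D ∧ ∀ d ∈ D, dot u d ≤ dot u x}
  let t : ℝ × ℝ → ℝ × ℝ := fun u => Classical.epsilon fun x => x ∈ A u
  have ht : ∀ u, t u ∈ A u := fun u =>
    Classical.epsilon_spec (hD.exists_isMaxOn hne (continuous_dot u).continuousOn)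
  refine ⟨t, fun u => (ht u).1, fun u => (ht u).2, fun c u hc => ?_, fun x hx => ?_⟩
  · have : A (c • u) = A u := by
      ext x
      simp only [A, Set.mem_ofPred_eq, dot_smul_left, mul_le_mul_iff_right₀ hc]
    simp only [t, this]
  · obtain ⟨u, c, hu, hc⟩ := hsep x hx
    exact ⟨u, (hu _ (ht u).1).trans_lt hc⟩

theorem exists_isSupport_Dk {P : Finset (ℝ × ℝ)} {k : ℕ} (hk : 3 * k < P.card) :
    ∃ t, IsSupport (Dk P k) t := by
  refine exists_isSupport (isCompact_Dk (by omega)) (Dk_nonempty hk) fun x hx => ?_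
  rw [Dk, Set.mem_sInter] at hx
  push Not at hx
  obtain ⟨_, ⟨⟨a, b, c, h0, rfl⟩, h1⟩, hx⟩ := hx
  refine ⟨(-a, -b), c, fun d hd => ?_, ?_⟩
  · have hd' : 0 ≤ a * d.1 + b * d.2 + c := Set.mem_sInter.1 hd _ ⟨⟨a, b, c, h0, rfl⟩, h1⟩
    simp only [dot]
    linarith
  · simp only [Set.mem_ofPred_eq, not_le] at hx
    simp only [dot]
    linarith

theorem exc_sub_exc (t : ℝ × ℝ → ℝ × ℝ) (u x y : ℝ × ℝ) :
    exc t u x - exc t u y = dot u x - dot u y := by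
  simp only [exc]
  ring

theorem convex_setOf_exc_pos (t : ℝ × ℝ → ℝ × ℝ) (u : ℝ × ℝ) : Convex ℝ {x | 0 < exc t u x} := by
  intro x hx y hy α β hα hβ hαβ
  have h1 : exc t u (α • x + β • y) = α * exc t u x + β * exc t u y := by
    simp only [exc, dot, Prod.fst_add, Prod.snd_add, Prod.smul_fst, Prod.smul_snd, smul_eq_mul]
    linear_combination (u.1 * (t u).1 + u.2 * (t u).2) * hαβ
  simp only [Set.mem_ofPred_eq] at *
  rw [h1]
  rcases hα.eq_or_lt with rfl | hα
  · rw [zero_add] at hαβ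
    simpa [hαβ] using hy
  · positivity

variable {P : Finset (ℝ × ℝ)} {k : ℕ} {D : Set (ℝ × ℝ)} {t : ℝ × ℝ → ℝ × ℝ}

/-- A region beyond a supporting line contains at most `2k` points outside `Dk P k`. -/
theorem IsSupport.ncard_le (S : IsSupport (Dk P k) t) (hk : 3 * k < P.card) {u : ℝ × ℝ}
    {K : Set (ℝ × ℝ)} (hu : ∀ x ∈ P, x ∉ Dk P k → exc t u x ≠ 0) (hK : ∀ x ∈ K, 0 ≤ exc t u x) :
    (((P : Set (ℝ × ℝ)) ∩ K) \ Dk P k).ncard ≤ 2 * k := by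
  have h1 : (((P : Set (ℝ × ℝ)) ∩ K) \ Dk P k) ⊆ (P : Set (ℝ × ℝ)) ∩ {x | 0 < exc t u x} := by
    rintro x ⟨⟨hx, hxK⟩, hxD⟩
    exact ⟨hx, lt_of_le_of_ne (hK x hxK) (hu x hx hxD).symm⟩
  refine (Set.ncard_le_ncard h1 (P.finite_toSet.inter_of_left _)).trans ?_
  by_contra! h
  obtain ⟨x, hx, hxD⟩ := inter_Dk_nonempty hk (convex_setOf_exc_pos t u) h
  exact S.notMem hx hxD

theorem IsSupport.mem_frontier (S : IsSupport D t) {u : ℝ × ℝ} (hu : u ≠ 0) :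
    t u ∈ frontier D := by
  refine ⟨subset_closure (S.mem u), fun h => ?_⟩
  have := lt_of_mem_interior (f := exc t u) (e := u) (fun x s => exc_add_smul t u x u s)
    (dot_self_pos hu) (fun x hx => S.exc_nonpos u hx) h
  rw [exc_self] at this
  exact this.false

theorem isClosedHalfplane_of_sub {f : ℝ × ℝ → ℝ} {n : ℝ × ℝ} (hn : n ≠ 0)
    (hf : ∀ x y, f x - f y = dot n x - dot n y) : IsClosedHalfplane {x | 0 ≤ f x} := by
  refine ⟨n.1, n.2, f 0, hn, ?_⟩
  ext x
  have := hf x 0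
  simp only [dot, Prod.fst_zero, Prod.snd_zero, mul_zero, add_zero, sub_zero] at this
  rw [Set.mem_ofPred_eq, Set.mem_ofPred_eq, ← this, sub_add_cancel]

theorem isClosedHalfplane_setOf_exc_nonneg (t : ℝ × ℝ → ℝ × ℝ) {u : ℝ × ℝ} (hu : u ≠ 0) :
    IsClosedHalfplane {x | 0 ≤ exc t u x} :=
  isClosedHalfplane_of_sub hu (exc_sub_exc t u)

theorem isClosedHalfplane_setOf_exc_nonpos (t : ℝ × ℝ → ℝ × ℝ) {u : ℝ × ℝ} (hu : u ≠ 0) :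
    IsClosedHalfplane {x | exc t u x ≤ 0} := by
  have := isClosedHalfplane_of_sub (f := fun x => -exc t u x) (neg_ne_zero.2 hu) fun x y => by
    have := exc_sub_exc t u x y
    simp only [dot, Prod.fst_neg, Prod.snd_neg] at *
    linarith
  simpa using this

theorem exists_halfplanes {H₁ H₂ H₃ : Set (ℝ × ℝ)} (h₁ : IsClosedHalfplane H₁)
    (h₂ : IsClosedHalfplane H₂) (h₃ : IsClosedHalfplane H₃) :
    ∃ F : Finset (Set (ℝ × ℝ)), F.card ≤ 3 ∧ (∀ H ∈ F, IsClosedHalfplane H) ∧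
      {x | x ∈ H₁ ∧ x ∈ H₂ ∧ x ∈ H₃} = ⋂₀ (F : Set (Set (ℝ × ℝ))) := by
  classical
  refine ⟨{H₁, H₂, H₃}, Finset.card_le_three, ?_, ?_⟩
  · simp [h₁, h₂, h₃]
  · ext x
    simp
    tauto

theorem IsCell.exists_halfplanes {a b : ℝ × ℝ} {w : Option (ℝ × ℝ)} (h : IsCell t a b w)
    (S : IsSupport D t) :
    ∃ F : Finset (Set (ℝ × ℝ)), F.card ≤ 3 ∧ (∀ H ∈ F, IsClosedHalfplane H) ∧
      cell t a b w = ⋂₀ (F : Set (Set (ℝ × ℝ))) :=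
  ShallowCover.exists_halfplanes (isClosedHalfplane_setOf_exc_nonpos t h.left_ne_zero)
    (isClosedHalfplane_setOf_exc_nonpos t h.right_ne_zero)
    (isClosedHalfplane_of_sub (h.wallDir_ne_zero S) (wall_sub t a b w))

theorem IsCell.inter_frontier_nonempty {a b : ℝ × ℝ} {w : Option (ℝ × ℝ)} (h : IsCell t a b w)
    (S : IsSupport D t) : (cell t a b w ∩ frontier D).Nonempty := by
  cases w with
  | none =>
    exact ⟨t a, ⟨S.exc_nonpos a (S.mem a), S.exc_nonpos b (S.mem a), (chord_left t a b).ge⟩,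
      S.mem_frontier h.left_ne_zero⟩
  | some w =>
    exact ⟨t w, ⟨S.exc_nonpos a (S.mem w), S.exc_nonpos b (S.mem w), (exc_self t w).ge⟩,
      S.mem_frontier (h.wallDir_ne_zero S)⟩

end Existence

section Sector

/-- The affine parametrization of the line through `A` and `B`. -/
def seg (A B : ℝ × ℝ) (s : ℝ) : ℝ × ℝ := (1 - s) • A + s • B

variable {A B : ℝ × ℝ}

theorem cross_seg (A B : ℝ × ℝ) (l r : ℝ) :
    cross (seg A B l) (seg A B r) = (r - l) * cross A B := by
  rw [seg, seg, cross_comb]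
  ring

theorem exists_eq_smul_seg {l r α β : ℝ} (h : 0 < α + β) :
    α • seg A B l + β • seg A B r = (α + β) • seg A B ((α * l + β * r) / (α + β)) := by
  simp only [seg]
  ext <;> simp <;> field_simp <;> ring

theorem seg_mem_openCone (hAB : 0 < cross A B) {l m r : ℝ} (h1 : l < m) (h2 : m < r) :
    seg A B m ∈ openCone (seg A B l) (seg A B r) := by
  rw [mem_openCone_iff] <;> simp only [cross_seg]
  · exact ⟨mul_pos (by linarith) hAB, mul_pos (by linarith) hAB⟩
  · exact mul_pos (by linarith) hAB

theorem exists_of_mem_openCone {l r : ℝ} (hlr : l < r) {z : ℝ × ℝ}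
    (hz : z ∈ openCone (seg A B l) (seg A B r)) :
    ∃ c m : ℝ, 0 < c ∧ l < m ∧ m < r ∧ z = c • seg A B m := by
  obtain ⟨α, β, hα, hβ, rfl⟩ := hz
  have h := add_pos hα hβ
  refine ⟨_, _, h, ?_, ?_, exists_eq_smul_seg h⟩
  · rw [lt_div_iff₀ h]
    nlinarith
  · rw [div_lt_iff₀ h]
    nlinarith

theorem exists_of_mem_closedCone {l r : ℝ} (hlr : l < r) {z : ℝ × ℝ} (hz0 : z ≠ 0)
    (hz : z ∈ closedCone (seg A B l) (seg A B r)) :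
    ∃ c m : ℝ, 0 < c ∧ l ≤ m ∧ m ≤ r ∧ z = c • seg A B m := by
  obtain ⟨α, β, hα, hβ, rfl⟩ := hz
  have h : 0 < α + β := by
    rcases hα.eq_or_lt with rfl | hα
    · rcases hβ.eq_or_lt with rfl | hβ
      · simp at hz0
      · linarith
    · linarith
  refine ⟨_, _, h, ?_, ?_, exists_eq_smul_seg h⟩
  · rw [le_div_iff₀ h]
    nlinarith
  · rw [div_le_iff₀ h]
    nlinarith

theorem seg_mem_openCone_iff (hAB : 0 < cross A B) {l m r : ℝ} (hlr : l < r) :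
    seg A B m ∈ openCone (seg A B l) (seg A B r) ↔ l < m ∧ m < r := by
  refine ⟨fun h => ?_, fun h => seg_mem_openCone hAB h.1 h.2⟩
  rw [mem_openCone_iff] at h <;> simp only [cross_seg] at *
  · exact ⟨by linarith [pos_of_mul_pos_left h.1 hAB.le],
      by linarith [pos_of_mul_pos_left h.2 hAB.le]⟩
  · exact mul_pos (by linarith) hAB

theorem openCone_seg_subset {l r : ℝ} (hlr : l < r) (hl : 0 ≤ l) (hr : r ≤ 1) :
    openCone (seg A B l) (seg A B r) ⊆ openCone A B := by
  intro z hz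
  obtain ⟨c, m, hc, hlm, hmr, rfl⟩ := exists_of_mem_openCone hlr hz
  refine ⟨c * (1 - m), c * m, mul_pos hc (by linarith), mul_pos hc (by linarith), ?_⟩
  rw [seg]
  module

theorem disjoint_openCone_seg (hAB : 0 < cross A B) {l r l' r' : ℝ} (hlr : l < r) (hlr' : l' < r')
    (h : r ≤ l') :
    Disjoint (openCone (seg A B l) (seg A B r)) (openCone (seg A B l') (seg A B r')) := by
  rw [Set.disjoint_left]
  intro z hz hz'
  obtain ⟨c, m, hc, hlm, hmr, rfl⟩ := exists_of_mem_openCone hlr hz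
  obtain ⟨c', m', hc', hlm', hmr', h1⟩ := exists_of_mem_openCone hlr' hz'
  have h2 : cross (c • seg A B m) (c' • seg A B m') = c * c' * ((m' - m) * cross A B) := by
    rw [← cross_seg]
    simp only [cross, Prod.smul_fst, Prod.smul_snd, smul_eq_mul]
    ring
  rw [h1, cross_self] at h2
  have : 0 < c * c' * ((m' - m) * cross A B) :=
    mul_pos (mul_pos hc hc') (mul_pos (by linarith) hAB)
  linarith

theorem IsCone.ordConnected_seg {J : Set (ℝ × ℝ)} (hJ : IsCone J) (A B : ℝ × ℝ) :
    {m | seg A B m ∈ J}.OrdConnected := by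
  refine ⟨fun l hl r hr m hm => ?_⟩
  rcases (hm.1.trans hm.2).eq_or_lt with h | h
  · have : m = l := le_antisymm (hm.2.trans h.ge) hm.1
    exact this ▸ hl
  · have h1 := hJ _ hl _ hr ((r - m) / (r - l)) ((m - l) / (r - l))
      (div_nonneg (by linarith [hm.2]) (by linarith))
      (div_nonneg (by linarith [hm.1]) (by linarith))
    have h2 : (r - m) / (r - l) + (m - l) / (r - l) = 1 := by
      have : r - l ≠ 0 := by linarith
      field_simp
      ring
    rw [exists_eq_smul_seg (by rw [h2]; exact one_pos), h2, one_smul, div_one] at h1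
    have h3 : (r - m) / (r - l) * l + (m - l) / (r - l) * r = m := by
      have : r - l ≠ 0 := by linarith
      field_simp
      ring
    rwa [h3] at h1

theorem MeetsCone.hit {J : Set (ℝ × ℝ)} (hJ : IsCone J) {L : Label} (hL : L.lo < L.hi)
    (h : MeetsCone J (seg A B L.lo) (seg A B L.hi)) : L.Hit {m | seg A B m ∈ J} := by
  obtain ⟨⟨z, hz, hz0, hzc⟩, h2⟩ := h
  obtain ⟨c, m, hc, hlm, hmr, rfl⟩ := exists_of_mem_closedCone hL hz0 hzc
  refine ⟨⟨m, ?_, hlm, hmr⟩, h2⟩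
  have := hJ _ hz _ hz c⁻¹ 0 (by positivity) le_rfl
  rwa [zero_smul, add_zero, smul_smul, inv_mul_cancel₀ hc.ne', one_smul] at this

theorem finite_of_forall_three {Z : Set ℝ} (h : ∀ l ∈ Z, ∀ m ∈ Z, ∀ r ∈ Z, l < m → m < r → False) :
    Z.Finite := by
  by_contra hZ
  obtain ⟨s, hs, hc⟩ := Set.Infinite.exists_subset_card_eq hZ 3
  have hm := fun i => hs (s.orderEmbOfFin_mem hc i)
  have hlt := (s.orderEmbOfFin hc).strictMono
  exact h _ (hm 0) _ (hm 1) _ (hm 2) (hlt (by decide)) (hlt (by decide))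

variable {D : Set (ℝ × ℝ)} {t : ℝ × ℝ → ℝ × ℝ}

theorem IsSupport.exc_pos_of_mem_openCone (S : IsSupport D t) {a b z x : ℝ × ℝ}
    (hab : cross a b ≠ 0) (hz : z ∈ openCone a b) (ha : 0 ≤ exc t a x) (hb : 0 ≤ exc t b x)
    (hx : x ∉ D) : 0 < exc t z x := by
  obtain ⟨μ, hμ⟩ := S.exists_exc_pos hx
  obtain ⟨ε, hε, α, β, hα, hβ, h⟩ := exists_add_smul_mem_openCone hab hz (-μ)
  have h1 : z = α • a + β • b + ε • μ := by
    rw [← h]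
    module
  have h2 := S.exc_comb_three hα.le hβ.le hε.le a b μ x
  rw [← h1] at h2
  have h3 := mul_nonneg hα.le ha
  have h4 := mul_nonneg hβ.le hb
  have h5 := mul_pos hε hμ
  linarith

theorem IsSupport.finite_setOf_exc_seg (S : IsSupport D t) (hAB : 0 < cross A B) {x : ℝ × ℝ}
    (hx : x ∉ D) : {m | exc t (seg A B m) x = 0}.Finite := by
  refine finite_of_forall_three fun l hl m hm r hr hlm hmr => ?_
  have h1 := S.exc_pos_of_mem_openCone (by
    rw [cross_seg]
    exact (mul_pos (by linarith) hAB).ne') (seg_mem_openCone hAB hlm hmr)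
    (ge_of_eq hl) (ge_of_eq hr) hx
  exact h1.ne' hm

/-- All but finitely many directions of a pencil are generic with respect to `P`. -/
theorem IsSupport.finite_setOf_exists_exc_seg (S : IsSupport D t) (hAB : 0 < cross A B)
    (P : Finset (ℝ × ℝ)) : {m | ∃ x ∈ P, x ∉ D ∧ exc t (seg A B m) x = 0}.Finite := by
  refine (P.finite_toSet.biUnion (t := fun x => {m | x ∉ D ∧ exc t (seg A B m) x = 0})
    fun x _ => ?_).subset ?_
  · by_cases hx : x ∈ D
    · simp [hx]
    · exact (S.finite_setOf_exc_seg hAB hx).subset fun m hm => hm.2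
  · rintro m ⟨x, hx, h⟩
    exact Set.mem_biUnion hx h

theorem IsSupport.concaveOn_exc_seg (S : IsSupport D t) (A B x : ℝ × ℝ) :
    ConcaveOn ℝ Set.univ fun m => exc t (seg A B m) x := by
  refine ⟨convex_univ, fun l _ r _ α β hα hβ hαβ => ?_⟩
  have h1 := S.exc_comb hα hβ (seg A B l) (seg A B r) x
  rwa [exists_eq_smul_seg (by rw [hαβ]; exact one_pos), hαβ, one_smul, div_one] at h1

/-- The directions of a sector in which `x` has positive excess form an interval. -/
theorem IsSupport.exists_arc (S : IsSupport D t) {x : ℝ × ℝ} (h0 : exc t (seg A B 0) x ≤ 0)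
    (h1 : exc t (seg A B 1) x ≤ 0) {m : ℝ} (hm0 : 0 < m) (hm1 : m < 1)
    (hm : 0 < exc t (seg A B m) x) :
    ∃ α β, α < β ∧ ∀ s, 0 < exc t (seg A B s) x ↔ α < s ∧ s < β := by
  have hconc := S.concaveOn_exc_seg A B x
  have hcont : Continuous fun s => exc t (seg A B s) x :=
    continuousOn_univ.1 (hconc.continuousOn isOpen_univ)
  set U := {s | 0 < exc t (seg A B s) x} with hU
  have hopen : IsOpen U := isOpen_lt continuous_const hcont
  have hconv : Convex ℝ U := by simpa using hconc.convex_gt 0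
  have hord : U.OrdConnected := hconv.ordConnected
  have hne : U.Nonempty := ⟨m, hm⟩
  have hlow : ∀ s ∈ U, 0 ≤ s := fun s hs => by
    by_contra! h
    exact h0.not_gt (hord.out hs hm ⟨h.le, hm0.le⟩)
  have hupp : ∀ s ∈ U, s ≤ 1 := fun s hs => by
    by_contra! h
    exact h1.not_gt (hord.out hm hs ⟨hm1.le, h.le⟩)
  have hbb : BddBelow U := ⟨0, hlow⟩
  have hba : BddAbove U := ⟨1, hupp⟩
  have hiff : ∀ s, s ∈ U ↔ sInf U < s ∧ s < sSup U := by
    intro s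
    constructor
    · intro hs
      obtain ⟨a, b, hab, hsub⟩ := mem_nhds_iff_exists_Ioo_subset.1 (hopen.mem_nhds hs)
      obtain ⟨a', ha', ha's⟩ := exists_between hab.1
      obtain ⟨b', hb', hb's⟩ := exists_between hab.2
      exact ⟨(csInf_le hbb (hsub ⟨ha', ha's.trans hab.2⟩)).trans_lt ha's,
        hb'.trans_le (le_csSup hba (hsub ⟨hab.1.trans hb', hb's⟩))⟩
    · exact fun hs => IsConnected.Ioo_csInf_csSup_subset ⟨hne, hconv.isPreconnected⟩ hbb hba hs
  obtain ⟨h2, h3⟩ := (hiff m).1 hm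
  exact ⟨sInf U, sSup U, h2.trans h3, hiff⟩

theorem arc_subset_iff {f : ℝ → ℝ} {α β a b : ℝ} (hαβ : α < β)
    (hf : ∀ s, 0 < f s ↔ α < s ∧ s < β) :
    a ≤ α ∧ β ≤ b ↔ f a ≤ 0 ∧ f b ≤ 0 ∧ ∃ m, a < m ∧ m < b ∧ 0 < f m := by
  constructor
  · rintro ⟨h1, h2⟩
    obtain ⟨m, hm1, hm2⟩ := exists_between hαβ
    refine ⟨?_, ?_, m, by linarith, by linarith, (hf m).2 ⟨hm1, hm2⟩⟩
    · by_contra! h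
      linarith [((hf a).1 h).1]
    · by_contra! h
      linarith [((hf b).1 h).2]
  · rintro ⟨h1, h2, m, ham, hmb, hm⟩
    obtain ⟨h3, h4⟩ := (hf m).1 hm
    constructor
    · by_contra! h
      exact h1.not_gt ((hf a).2 ⟨h, by linarith⟩)
    · by_contra! h
      exact h2.not_gt ((hf b).2 ⟨by linarith, h⟩)

end Sector

section SectorCover

/-- The cell described by a triple of directions. -/
abbrev tripleCell (t : ℝ × ℝ → ℝ × ℝ) (c : (ℝ × ℝ) × (ℝ × ℝ) × Option (ℝ × ℝ)) : Set (ℝ × ℝ) :=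
  cell t c.1 c.2.1 c.2.2

open Classical in
/-- A family of cells covering the points of `P` outside `Dk P k` that lie above the support in a
direction between `A` and `B`, but not in the directions `A` and `B` themselves. -/
structure IsSectorCover (P : Finset (ℝ × ℝ)) (k : ℕ) (t : ℝ × ℝ → ℝ × ℝ) (A B : ℝ × ℝ) (h : ℕ)
    (C : Finset ((ℝ × ℝ) × (ℝ × ℝ) × Option (ℝ × ℝ))) : Prop where
  isCell : ∀ c ∈ C, IsCell t c.1 c.2.1 c.2.2
  subset : ∀ c ∈ C, openCone c.1 c.2.1 ⊆ openCone A B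
  ncard_le : ∀ c ∈ C, (((P : Set (ℝ × ℝ)) ∩ tripleCell t c) \ Dk P k).ncard ≤ 2 * k
  covers : ∀ x ∈ P, exc t A x ≤ 0 → exc t B x ≤ 0 → (∃ μ ∈ openCone A B, 0 < exc t μ x) →
    ∃ c ∈ C, x ∈ tripleCell t c
  interior_inter : ∀ c ∈ C, ∀ c' ∈ C, c ≠ c' →
    interior (tripleCell t c) ∩ interior (tripleCell t c') = ∅
  hit : ∀ J, IsCone J → (C.filter fun c => MeetsCone J c.1 c.2.1).card ≤ h

variable {P : Finset (ℝ × ℝ)} {k : ℕ} {t : ℝ × ℝ → ℝ × ℝ} {A B : ℝ × ℝ}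

/-- The triple of directions of a label. -/
def Label.triple (A B : ℝ × ℝ) (L : Label) : (ℝ × ℝ) × (ℝ × ℝ) × Option (ℝ × ℝ) :=
  (seg A B L.lo, seg A B L.hi, L.cut.map (seg A B))

theorem exists_isSectorCover (S : IsSupport (Dk P k) t) (hk : 3 * k < P.card)
    (hAB : 0 < cross A B) {d : ℕ} (hd : P.card ≤ 2 * k * 2 ^ d) :
    ∃ C, IsSectorCover P k t A B (2 * (d + 1)) C := by
  classical
  have hA : seg A B 0 = A := by simp [seg]
  have hB : seg A B 1 = B := by simp [seg]
  set Q := P.filter fun x => exc t A x ≤ 0 ∧ exc t B x ≤ 0 ∧ ∃ m, 0 < m ∧ m < 1 ∧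
    0 < exc t (seg A B m) x with hQ
  have hQ' : ∀ x, x ∈ Q ↔ x ∈ P ∧ exc t A x ≤ 0 ∧ exc t B x ≤ 0 ∧ ∃ m, 0 < m ∧ m < 1 ∧
      0 < exc t (seg A B m) x := fun x => by rw [hQ, Finset.mem_filter]
  have harc : ∀ x, ∃ α β : ℝ, x ∈ Q → α < β ∧ ∀ s, 0 < exc t (seg A B s) x ↔ α < s ∧ s < β := by
    intro x
    by_cases hx : x ∈ Q
    · obtain ⟨-, h0, h1, m, hm0, hm1, hm⟩ := (hQ' x).1 hx
      obtain ⟨α, β, h⟩ := S.exists_arc (A := A) (B := B) (by rwa [hA]) (by rwa [hB]) hm0 hm1 hm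
      exact ⟨α, β, fun _ => h⟩
    · exact ⟨0, 0, fun h => absurd h hx⟩
  choose α β harc using harc
  have hmem : ∀ {a b : ℝ} {x}, x ∈ arcsIn Q α β a b ↔ x ∈ Q ∧
      exc t (seg A B a) x ≤ 0 ∧ exc t (seg A B b) x ≤ 0 ∧
      ∃ m, a < m ∧ m < b ∧ 0 < exc t (seg A B m) x := by
    intro a b x
    rw [mem_arcsIn]
    refine and_congr_right fun hx => ?_
    exact arc_subset_iff (f := fun s => exc t (seg A B s) x) (harc x hx).1 (harc x hx).2
  obtain ⟨T, hT⟩ := exists_isSubdivision (Q := Q) (α := α) (β := β) (fun x hx => (harc x hx).1)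
    (S.finite_setOf_exists_exc_seg hAB P) (2 * k) d 0 1 one_pos
    ((Finset.card_le_card fun x hx =>
      (Finset.filter_subset _ P) (((mem_arcsIn Q α β).1 hx).1)).trans hd)
  have hcross : ∀ L ∈ T, 0 < cross (seg A B L.lo) (seg A B L.hi) := by
    intro L hL
    rw [cross_seg]
    exact mul_pos (sub_pos.2 (hT.bounds L hL).2.1) hAB
  have hcell : ∀ L ∈ T, IsCell t (seg A B L.lo) (seg A B L.hi) (L.cut.map (seg A B)) := by
    intro L hL
    obtain ⟨h0, hlt, h1⟩ := hT.bounds L hL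
    refine ⟨hcross L hL, fun v hv => ?_, ?_⟩
    · obtain ⟨w, hw, rfl⟩ := Option.mem_map.1 hv
      obtain ⟨h2, h3, -⟩ := hT.cut L hL w hw
      exact seg_mem_openCone hAB h2 h3
    · obtain ⟨x, hx⟩ := hT.pos L hL
      obtain ⟨-, h2, h3, m, h4, h5, h6⟩ := hmem.1 hx
      exact ⟨x, _, h2, h3, seg_mem_openCone hAB h4 h5, h6⟩
  have hsep : ∀ L ∈ T, ∀ M ∈ T, L ≠ M →
      interior (tripleCell t (L.triple A B)) ∩ interior (tripleCell t (M.triple A B)) = ∅ := by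
    intro L hL M hM hLM
    have hLb := (hT.bounds L hL).2.1
    have hMb := (hT.bounds M hM).2.1
    refine (hcell L hL).interior_inter (hcell M hM) S ?_
    rcases hT.sep L hL M hM hLM with h | h | ⟨w, hw, h⟩ | ⟨w, hw, h⟩
    · exact Or.inl (disjoint_openCone_seg hAB hLb hMb h)
    · exact Or.inl (disjoint_openCone_seg hAB hMb hLb h).symm
    · exact Or.inr (Or.inl ⟨_, Option.mem_map_of_mem _ hw, mt (seg_mem_openCone_iff hAB hMb).1 h⟩)
    · exact Or.inr (Or.inr ⟨_, Option.mem_map_of_mem _ hw, mt (seg_mem_openCone_iff hAB hLb).1 h⟩)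
  refine ⟨T.image (Label.triple A B), ?_, ?_, ?_, ?_, ?_, ?_⟩
  · exact Finset.forall_mem_image.2 fun L hL => hcell L hL
  · refine Finset.forall_mem_image.2 fun L hL => ?_
    obtain ⟨h0, hlt, h1⟩ := hT.bounds L hL
    exact openCone_seg_subset hlt h0 h1
  · refine Finset.forall_mem_image.2 fun L hL => ?_
    obtain ⟨h0, hlt, h1⟩ := hT.bounds L hL
    cases hw : L.cut with
    | some w =>
      obtain ⟨-, -, h2⟩ := hT.cut L hL w hw
      refine S.ncard_le hk (u := seg A B w) (fun x hx hxD h => h2 ⟨x, hx, hxD, h⟩) fun x hx => ?_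
      have := hx.2.2
      rwa [Label.triple, hw] at this
    | none =>
      have := hT.leaf L hL hw
      rw [← Set.ncard_coe_finset] at this
      refine (Set.ncard_le_ncard ?_ (Finset.finite_toSet _)).trans this
      rintro x ⟨⟨hxP, hx⟩, hxD⟩
      obtain ⟨μ, hμ, hμx⟩ := (hcell L hL).exists_exc_pos S hx hxD
      obtain ⟨c, m, hc, hlm, hmr, rfl⟩ := exists_of_mem_openCone hlt hμ
      rw [S.exc_smul hc] at hμx
      have hmx := pos_of_mul_pos_right hμx hc.le
      have key : ∀ s, ¬ (L.lo < s ∧ s < L.hi) → exc t (seg A B s) x ≤ 0 := fun s hs => by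
        by_contra! h
        exact hs ((seg_mem_openCone_iff hAB hlt).1 ((hcell L hL).mem_openCone S hx hxD h))
      refine hmem.2 ⟨(hQ' x).2 ⟨hxP, ?_, ?_, m, h0.trans_lt hlm, hmr.trans_le h1, hmx⟩,
        hx.1, hx.2.1, m, hlm, hmr, hmx⟩
      · rw [← hA]
        exact key 0 fun h => h.1.not_ge h0
      · rw [← hB]
        exact key 1 fun h => h.2.not_ge h1
  · intro x hx hxA hxB ⟨μ, hμ, hμx⟩
    obtain ⟨c, m, hc, h0m, hm1, rfl⟩ := exists_of_mem_openCone (A := A) (B := B) one_pos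
      (by rwa [hA, hB])
    rw [S.exc_smul hc] at hμx
    have hxQ : x ∈ Q := (hQ' x).2 ⟨hx, hxA, hxB, m, h0m, hm1, pos_of_mul_pos_right hμx hc.le⟩
    obtain ⟨L, hL, h2, h3, h4⟩ := hT.covers x (hmem.2 ⟨hxQ, by rwa [hA], by rwa [hB],
      m, h0m, hm1, pos_of_mul_pos_right hμx hc.le⟩)
    obtain ⟨h0, hlt, h1⟩ := hT.bounds L hL
    refine ⟨_, Finset.mem_image_of_mem _ hL, ?_⟩
    obtain ⟨-, h5, h6, m', h7, h8, h9⟩ := hmem.1 ((mem_arcsIn Q α β).2 ⟨hxQ, h2, h3⟩)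
    refine ⟨h5, h6, ?_⟩
    cases hw : L.cut with
    | some w =>
      have := ((harc x hxQ).2 w).2 (h4 w hw)
      rw [Label.triple, hw]
      exact this.le
    | none =>
      rw [Label.triple, hw]
      exact (S.exc_lt_of_mem_openCone h5 h6 (seg_mem_openCone hAB h7 h8) h9).2.2
  · simp only [Finset.forall_mem_image]
    intro L hL M hM hne
    exact hsep L hL M hM fun h => hne (congrArg _ h)
  · intro J hJ
    refine le_trans ?_ (hT.hit_all _ (hJ.ordConnected_seg A B))
    rw [Finset.filter_image]
    refine Finset.card_image_le.trans (Finset.card_le_card fun L hL => ?_)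
    rw [Finset.mem_filter] at hL ⊢
    exact ⟨hL.1, hL.2.hit hJ (hT.bounds L hL.1).2.1⟩

end SectorCover

section Pinwheel

/-- Three directions, in counterclockwise order, that positively span the plane. -/
def IsPinwheel (a : Fin 3 → ℝ × ℝ) : Prop := ∀ i, 0 < cross (a i) (a (i + 1))

variable {a : Fin 3 → ℝ × ℝ}

theorem IsPinwheel.ne_zero (ha : IsPinwheel a) (i : Fin 3) : a i ≠ 0 :=
  ne_zero_of_cross_left (ha i).ne'

theorem IsPinwheel.notMem_openCone (ha : IsPinwheel a) (i j : Fin 3) :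
    a j ∉ openCone (a i) (a (i + 1)) := by
  rw [mem_openCone_iff (ha i)]
  rintro ⟨h1, h2⟩
  have hij : j = i ∨ j = i + 1 ∨ j + 1 = i := by
    clear h1 h2
    revert i j
    decide
  rcases hij with rfl | rfl | rfl
  · rw [cross_self] at h1
    exact h1.false
  · rw [cross_self] at h2
    exact h2.false
  · rw [cross_swap] at h1
    linarith [ha j]

theorem IsPinwheel.disjoint_openCone_succ (ha : IsPinwheel a) (i : Fin 3) :
    Disjoint (openCone (a i) (a (i + 1))) (openCone (a (i + 1)) (a (i + 1 + 1))) := by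
  rw [Set.disjoint_left]
  intro z hz hz'
  rw [mem_openCone_iff (ha _)] at hz hz'
  have h := hz'.1
  rw [cross_swap] at h
  linarith [hz.2]

theorem IsPinwheel.disjoint_openCone (ha : IsPinwheel a) {i j : Fin 3} (hij : i ≠ j) :
    Disjoint (openCone (a i) (a (i + 1))) (openCone (a j) (a (j + 1))) := by
  have h : j = i + 1 ∨ i = j + 1 := by
    revert i j
    decide
  rcases h with rfl | rfl
  · exact ha.disjoint_openCone_succ i
  · exact (ha.disjoint_openCone_succ j).symm

theorem mem_closedCone_of_cross {b c z : ℝ × ℝ} (h : 0 < cross b c) (h1 : 0 ≤ cross b z)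
    (h2 : 0 ≤ cross z c) : z ∈ closedCone b c :=
  ⟨_, _, div_nonneg h2 h.le, div_nonneg h1 h.le, eq_comb h.ne' z⟩

theorem IsPinwheel.exists_mem_closedCone (ha : IsPinwheel a) (z : ℝ × ℝ) :
    ∃ i, z ∈ closedCone (a i) (a (i + 1)) := by
  by_contra! hz
  have h : ∀ i, 0 ≤ cross (a i) z → 0 < cross (a (i + 1)) z := by
    intro i hi
    by_contra! h
    exact hz i (mem_closedCone_of_cross (ha i) hi (by rw [cross_swap]; linarith))
  have h0 := h 0
  have h1 := h 1
  have h2 := h 2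
  have a0 := ha 0
  have a1 := ha 1
  have a2 := ha 2
  have hsum : cross (a 1) (a 2) * cross (a 0) z + cross (a 2) (a 0) * cross (a 1) z +
      cross (a 0) (a 1) * cross (a 2) z = 0 := by
    simp only [cross]
    ring
  simp only [Fin.isValue, zero_add, show (1 : Fin 3) + 1 = 2 from rfl,
    show (2 : Fin 3) + 1 = 0 from rfl] at *
  rcases le_or_gt 0 (cross (a 0) z) with h3 | h3
  · have h4 := h0 h3
    have h5 := h1 h4.le
    linarith [mul_nonneg a1.le h3, mul_pos a2 h4, mul_pos a0 h5]
  · have h5 : cross (a 2) z < 0 := by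
      by_contra! h
      linarith [h2 h]
    have h4 : cross (a 1) z < 0 := by
      by_contra! h
      linarith [h1 h]
    linarith [mul_neg_of_pos_of_neg a1 h3, mul_neg_of_pos_of_neg a2 h4,
      mul_neg_of_pos_of_neg a0 h5]

variable {D : Set (ℝ × ℝ)} {t : ℝ × ℝ → ℝ × ℝ}

theorem IsSupport.exists_generic (S : IsSupport D t) {A B : ℝ × ℝ} (hAB : 0 < cross A B)
    (P : Finset (ℝ × ℝ)) :
    ∃ s : ℝ, 0 < s ∧ s < 1 ∧ ∀ x ∈ P, x ∉ D → exc t (seg A B s) x ≠ 0 := by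
  obtain ⟨s, hs, h⟩ := (Set.Ioo_infinite (zero_lt_one' ℝ)).exists_notMem_finite
    (S.finite_setOf_exists_exc_seg hAB P)
  exact ⟨s, hs.1, hs.2, fun x hx hxD h0 => h ⟨x, hx, hxD, h0⟩⟩

theorem IsSupport.exists_isPinwheel (S : IsSupport D t) (P : Finset (ℝ × ℝ)) :
    ∃ a, IsPinwheel a ∧ ∀ i, ∀ x ∈ P, x ∉ D → exc t (a i) x ≠ 0 := by
  obtain ⟨p, hp0, hp1, hp⟩ := S.exists_generic (A := (1, 1)) (B := (1, 2))
    (by norm_num [cross]) P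
  obtain ⟨q, hq0, hq1, hq⟩ := S.exists_generic (A := (-1, 2)) (B := (-1, 1))
    (by norm_num [cross]) P
  obtain ⟨r, hr0, hr1, hr⟩ := S.exists_generic (A := (-1 / 2, -1)) (B := (1 / 2, -1))
    (by norm_num [cross]) P
  refine ⟨![seg (1, 1) (1, 2) p, seg (-1, 2) (-1, 1) q, seg (-1 / 2, -1) (1 / 2, -1) r], ?_, ?_⟩
  · intro i
    fin_cases i <;> simp [cross, seg] <;> nlinarith
  · intro i
    fin_cases i
    exacts [hp, hq, hr]

/-- The points above the support in direction `a i`, but not in the previous directions. -/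
def rootRegion (t : ℝ × ℝ → ℝ × ℝ) (a : Fin 3 → ℝ × ℝ) (i : Fin 3) : Set (ℝ × ℝ) :=
  {x | 0 ≤ exc t (a i) x ∧ ∀ j < i, exc t (a j) x ≤ 0}

theorem IsPinwheel.exists_halfplanes (ha : IsPinwheel a) (t : ℝ × ℝ → ℝ × ℝ) (i : Fin 3) :
    ∃ F : Finset (Set (ℝ × ℝ)), F.card ≤ 3 ∧ (∀ H ∈ F, IsClosedHalfplane H) ∧
      rootRegion t a i = ⋂₀ (F : Set (Set (ℝ × ℝ))) := by
  have hp := fun i => isClosedHalfplane_setOf_exc_nonneg t (ha.ne_zero i)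
  have hm := fun i => isClosedHalfplane_setOf_exc_nonpos t (ha.ne_zero i)
  fin_cases i
  · convert ShallowCover.exists_halfplanes (hp 0) (hp 0) (hp 0) using 5
    ext x
    simp [rootRegion]
  · convert ShallowCover.exists_halfplanes (hp 1) (hm 0) (hm 0) using 5
    ext x
    simp [rootRegion]
  · convert ShallowCover.exists_halfplanes (hp 2) (hm 0) (hm 1) using 5
    ext x
    simp [rootRegion, Fin.forall_fin_succ]

theorem IsPinwheel.rootRegion_inter_frontier (ha : IsPinwheel a) (S : IsSupport D t) (i : Fin 3) :
    (rootRegion t a i ∩ frontier D).Nonempty :=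
  ⟨t (a i), ⟨(exc_self t _).ge, fun j _ => S.exc_nonpos (a j) (S.mem _)⟩,
    S.mem_frontier (ha.ne_zero i)⟩

theorem IsPinwheel.exc_pos_of_mem_interior (ha : IsPinwheel a) {i : Fin 3} {x : ℝ × ℝ}
    (hx : x ∈ interior (rootRegion t a i)) : 0 < exc t (a i) x := by
  have := lt_of_mem_interior (f := fun x => -exc t (a i) x) (e := (-1 : ℝ) • a i)
    (m := dot (a i) (a i)) (fun x s => ?_) (dot_self_pos (ha.ne_zero i))
    (fun x hx => neg_nonpos.2 hx.1) hx
  · linarith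
  · rw [smul_smul, exc_add_smul]
    ring

theorem IsPinwheel.interior_inter_of_lt (ha : IsPinwheel a) {i j : Fin 3} (hij : i < j) :
    interior (rootRegion t a i) ∩ interior (rootRegion t a j) = ∅ := by
  rw [Set.eq_empty_iff_forall_notMem]
  rintro x ⟨hx, hx'⟩
  exact (ha.exc_pos_of_mem_interior hx).not_ge ((interior_subset hx').2 i hij)

theorem IsPinwheel.interior_inter (ha : IsPinwheel a) {i j : Fin 3} (hij : i ≠ j) :
    interior (rootRegion t a i) ∩ interior (rootRegion t a j) = ∅ := by
  rcases hij.lt_or_gt with h | h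
  · exact ha.interior_inter_of_lt h
  · rw [Set.inter_comm]
    exact ha.interior_inter_of_lt h

theorem IsPinwheel.interior_inter_cell (ha : IsPinwheel a) (S : IsSupport D t) {b c : ℝ × ℝ}
    {w : Option (ℝ × ℝ)} (h : IsCell t b c w) (i j : Fin 3)
    (hsub : openCone b c ⊆ openCone (a j) (a (j + 1))) :
    interior (rootRegion t a i) ∩ interior (cell t b c w) = ∅ := by
  rw [Set.eq_empty_iff_forall_notMem]
  rintro x ⟨hx, hx'⟩
  have h1 := ha.exc_pos_of_mem_interior hx
  exact ha.notMem_openCone j i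
    (hsub (h.mem_openCone S (interior_subset hx') (S.notMem h1) h1))

end Pinwheel

section Cover

/-- The cover, with the number of regions met by a line bounded in terms of the depth of the
subdivisions. -/
theorem exists_cover {P : Finset (ℝ × ℝ)} {k d : ℕ} (hk : 3 * k < P.card)
    (hd : P.card ≤ 2 * k * 2 ^ d) :
    ∃ G : Finset (Set (ℝ × ℝ)),
      (∀ K ∈ G, ∃ F : Finset (Set (ℝ × ℝ)), F.card ≤ 3 ∧ (∀ H ∈ F, IsClosedHalfplane H) ∧
        K = ⋂₀ (F : Set (Set (ℝ × ℝ)))) ∧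
      (∀ K ∈ G, ∀ K' ∈ G, K ≠ K' → interior K ∩ interior K' = ∅) ∧
      (∀ x ∈ P, x ∉ Dk P k → ∃ K ∈ G, x ∈ K) ∧
      (∀ K ∈ G, (((P : Set (ℝ × ℝ)) ∩ K) \ Dk P k).ncard ≤ 2 * k) ∧
      (∀ K ∈ G, (K ∩ frontier (Dk P k)).Nonempty) ∧
      ∀ n : ℝ × ℝ, n ≠ 0 → ∀ m : ℝ,
        {K | K ∈ G ∧ ∃ x ∈ K, dot n x = m}.ncard ≤ 24 * (d + 1) + 3 := by
  classical
  obtain ⟨t, S⟩ := exists_isSupport_Dk hk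
  obtain ⟨a, ha, hgen⟩ := S.exists_isPinwheel P
  choose C hC using fun i => exists_isSectorCover S hk (ha i) hd
  obtain ⟨G, hG⟩ : ∃ G : Finset (Set (ℝ × ℝ)), ∀ K, K ∈ G ↔
      (∃ i, rootRegion t a i = K) ∨ ∃ i, ∃ c ∈ C i, tripleCell t c = K :=
    ⟨Finset.univ.image (rootRegion t a) ∪
      Finset.univ.biUnion fun i => (C i).image (tripleCell t), fun K => by simp⟩
  refine ⟨G, ?_, ?_, ?_, ?_, ?_, ?_⟩ <;> try simp only [hG]
  · rintro K (⟨i, rfl⟩ | ⟨i, c, hc, rfl⟩)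
    · exact ha.exists_halfplanes t i
    · exact ((hC i).isCell c hc).exists_halfplanes S
  · have key : ∀ i j, ∀ c ∈ C j,
        interior (rootRegion t a i) ∩ interior (tripleCell t c) = ∅ := fun i j c hc =>
      ha.interior_inter_cell S ((hC j).isCell c hc) i j ((hC j).subset c hc)
    rintro K (⟨i, rfl⟩ | ⟨i, c, hc, rfl⟩) K' (⟨j, rfl⟩ | ⟨j, c', hc', rfl⟩) hne
    · exact ha.interior_inter fun h => hne (congrArg _ h)
    · exact key i j c' hc'
    · rw [Set.inter_comm]
      exact key j i c hc
    · by_cases hij : i = j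
      · subst hij
        exact (hC i).interior_inter c hc c' hc' fun h => hne (congrArg _ h)
      · exact ((hC i).isCell c hc).interior_inter ((hC j).isCell c' hc') S (Or.inl
          ((ha.disjoint_openCone hij).mono ((hC i).subset c hc) ((hC j).subset c' hc')))
  · intro x hx hxD
    by_cases h : ∃ i, x ∈ rootRegion t a i
    · obtain ⟨i, hi⟩ := h
      exact ⟨_, Or.inl ⟨i, rfl⟩, hi⟩
    · push Not at h
      have hle : ∀ i, exc t (a i) x ≤ 0 := by
        intro i
        induction i using WellFoundedLT.induction with
        | _ i ih =>
          by_contra! hi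
          exact h i ⟨hi.le, ih⟩
      obtain ⟨μ, hμ⟩ := S.exists_exc_pos hxD
      obtain ⟨i, hi⟩ := ha.exists_mem_closedCone μ
      obtain ⟨c, hc, hxc⟩ := (hC i).covers x hx (hle _) (hle _)
        ⟨μ, S.mem_openCone_of_mem_closedCone (hle _) (hle _) hi hμ, hμ⟩
      exact ⟨_, Or.inr ⟨i, c, hc, rfl⟩, hxc⟩
  · rintro K (⟨i, rfl⟩ | ⟨i, c, hc, rfl⟩)
    · exact S.ncard_le hk (hgen i) fun x hx => hx.1
    · exact (hC i).ncard_le c hc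
  · rintro K (⟨i, rfl⟩ | ⟨i, c, hc, rfl⟩)
    · exact ha.rootRegion_inter_frontier S i
    · exact ((hC i).isCell c hc).inter_frontier_nonempty S
  · intro n hn m
    obtain ⟨J, hJ, hmeet⟩ :=
      S.exists_isCone_of_line (isCompact_Dk (by omega)) (convex_Dk P k) hn m
    have hsub : {K | ((∃ i, rootRegion t a i = K) ∨ ∃ i, ∃ c ∈ C i, tripleCell t c = K) ∧
          ∃ x ∈ K, dot n x = m} ⊆
        (Finset.univ.image (rootRegion t a) ∪ (Finset.univ : Finset (Fin 3 × Fin 4)).biUnion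
          fun p => ((C p.1).filter fun c => MeetsCone (J p.2) c.1 c.2.1).image (tripleCell t) :
          Finset (Set (ℝ × ℝ))) := by
      rintro K ⟨⟨i, rfl⟩ | ⟨i, c, hc, rfl⟩, x, hx, hxm⟩
      · exact Finset.mem_union_left _ (Finset.mem_image_of_mem _ (Finset.mem_univ i))
      · obtain ⟨j, hj⟩ := hmeet _ _ _ ((hC i).isCell c hc) x hx hxm
        exact Finset.mem_union_right _ (Finset.mem_biUnion.2 ⟨(i, j), Finset.mem_univ _,
          Finset.mem_image_of_mem _ (Finset.mem_filter.2 ⟨hc, hj⟩)⟩)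
    have h1 : (Finset.univ.image (rootRegion t a)).card ≤ 3 :=
      Finset.card_image_le.trans (by simp)
    have h2 := Finset.card_biUnion_le_card_mul (Finset.univ : Finset (Fin 3 × Fin 4))
      (fun p => ((C p.1).filter fun c => MeetsCone (J p.2) c.1 c.2.1).image (tripleCell t))
      (2 * (d + 1)) fun p _ => Finset.card_image_le.trans ((hC p.1).hit _ (hJ p.2))
    rw [Finset.card_univ, Fintype.card_prod, Fintype.card_fin, Fintype.card_fin] at h2
    have h3 := (Set.ncard_le_ncard hsub (Finset.finite_toSet _)).trans
      ((Set.ncard_coe_finset _).le.trans (Finset.card_union_le _ _))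
    omega

theorem depth_le_log {n k : ℕ} (hk1 : 1 ≤ k) (hk : 3 * k < n) :
    ((24 * (Nat.log 2 (n / k) + 1) + 3 : ℕ) : ℝ) ≤ 75 * Real.log (2 * n / k) := by
  have hk0 : (0 : ℝ) < k := by exact_mod_cast hk1
  have hkn : 3 * (k : ℝ) < n := by exact_mod_cast hk
  have h1 : 1 ≤ Real.log (2 * n / k) := by
    rw [Real.le_log_iff_exp_le (div_pos (by linarith) hk0), le_div_iff₀ hk0]
    nlinarith [Real.exp_one_lt_d9]
  have h2 : 2 ^ Nat.log 2 (n / k) * k ≤ n :=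
    (Nat.mul_le_mul_right k (Nat.pow_log_le_self 2 (Nat.div_pos (by omega) hk1).ne')).trans
      (Nat.div_mul_le_self n k)
  have h3 : (Nat.log 2 (n / k) : ℝ) * Real.log 2 ≤ Real.log (2 * n / k) := by
    rw [← Real.log_pow]
    refine Real.log_le_log (by positivity) ?_
    rw [le_div_iff₀ hk0]
    have : (2 : ℝ) ^ Nat.log 2 (n / k) * k ≤ n := by exact_mod_cast h2
    linarith
  have h4 : (Nat.log 2 (n / k) : ℝ) ≤ 2 * Real.log (2 * n / k) := by
    nlinarith [Real.log_two_gt_d9, Nat.cast_nonneg (α := ℝ) (Nat.log 2 (n / k))]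
  push_cast
  linarith

end Cover

end ShallowCover

/-- The set `P \ Dk(P)` can be covered by convex regions (each an intersection
of at most three closed halfplanes) with pairwise disjoint interiors, each
containing at most `2k` points of `P \ Dk(P)` and touching `∂ Dk(P)`, such
that every line meets at most `C·log(2n/k)` of the regions. -/
theorem cover_of_shallow_points :
    ∃ C : ℝ, 0 < C ∧
      ∀ (P : Finset (ℝ × ℝ)) (k : ℕ), 1 ≤ k → 3 * k < P.card →
        ∃ (u : ℕ) (Cs : Fin u → Set (ℝ × ℝ)),
          (∀ i, ∃ S : Finset (Set (ℝ × ℝ)), S.card ≤ 3 ∧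
            (∀ H ∈ S, IsClosedHalfplane H) ∧ Cs i = ⋂₀ (↑S : Set (Set (ℝ × ℝ)))) ∧
          (∀ i j, i ≠ j → interior (Cs i) ∩ interior (Cs j) = ∅) ∧
          (∀ p ∈ P, p ∉ Dk P k → ∃ i, p ∈ Cs i) ∧
          (∀ i, ((((↑P : Set (ℝ × ℝ)) ∩ Cs i) \ Dk P k).ncard) ≤ 2 * k) ∧
          (∀ i, (Cs i ∩ frontier (Dk P k)).Nonempty) ∧
          (∀ a b c : ℝ, (a, b) ≠ (0, 0) →
            (({i : Fin u |
                ({x : ℝ × ℝ | a * x.1 + b * x.2 + c = 0} ∩ Cs i).Nonempty}).ncard : ℝ)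
              ≤ C * Real.log (2 * (P.card : ℝ) / (k : ℝ))) := by
  refine ⟨75, by norm_num, fun P k hk1 hk => ?_⟩
  have hd : P.card ≤ 2 * k * 2 ^ Nat.log 2 (P.card / k) := by
    have := (Nat.div_lt_iff_lt_mul hk1).1 (Nat.lt_pow_succ_log_self one_lt_two (P.card / k))
    rw [pow_succ] at this
    linarith
  obtain ⟨G, h1, h2, h3, h4, h5, h6⟩ := ShallowCover.exists_cover hk hd
  have hG := fun i => (G.equivFin.symm i).2
  refine ⟨G.card, fun i => G.equivFin.symm i, fun i => h1 _ (hG i), fun i j hij => ?_, ?_,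
    fun i => h4 _ (hG i), fun i => h5 _ (hG i), fun a b c hab => ?_⟩
  · exact h2 _ (hG i) _ (hG j) fun h => hij (G.equivFin.symm.injective (Subtype.ext h))
  · intro x hx hxD
    obtain ⟨K, hK, hxK⟩ := h3 x hx hxD
    exact ⟨G.equivFin ⟨K, hK⟩, by simpa using hxK⟩
  · refine le_trans ?_ (ShallowCover.depth_le_log hk1 hk)
    refine Nat.cast_le.2 (le_trans ?_ (h6 (a, b) hab (-c)))
    refine Set.ncard_le_ncard_of_injOn (fun i => (G.equivFin.symm i : Set (ℝ × ℝ))) ?_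
      (fun i _ j _ h => G.equivFin.symm.injective (Subtype.ext h))
      (G.finite_toSet.subset fun K hK => hK.1)
    rintro i ⟨x, hx, hxi⟩
    refine ⟨hG i, x, hxi, ?_⟩
    rw [Set.mem_ofPred_eq] at hx
    simp only [ShallowCover.dot]
    linarith
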